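/- Let k be an algebraically closed field of characteristic 0 or of characteristic p ≥ 7. There are exactly two conjugacy classes of regular homomorphisms ψ : A_5 → PGL_4(k); moreover, exactly one of the two classes contains a homomorphism of the form π∘ρ where ρ : A_5 → GL_4(k) is a homomorphism and π : GL_4(k) → PGL_4(k) is the quotient map (i.e. exactly one of the two classes lifts to GL_4(k)). -/

import Mathlib

/-- The alternating group on 5 letters. -/
abbrev A5 := alternatingGroup (Fin 5)

/-- The general linear group `GL_m(k)`. -/
abbrev GLmk (m : ℕ) (k : Type) [Field k] := Matrix.GeneralLinearGroup (Fin m) k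

/-- The projective general linear group `PGL_m(k)`, the quotient of `GL_m(k)` by its
centre (the scalar matrices). -/
abbrev PGLmk (m : ℕ) (k : Type) [Field k] :=
  GLmk m k ⧸ Subgroup.center (GLmk m k)

/-- The quotient map `GL_m(k) → PGL_m(k)`. -/
def pglQuot (m : ℕ) (k : Type) [Field k] : GLmk m k →* PGLmk m k :=
  QuotientGroup.mk' _

/-- A homomorphism `ψ : A₅ → PGL_m(k)` is regular if the preimage of `ψ(A₅)` under the
quotient map `GL_m(k) → PGL_m(k)` acts irreducibly on `k^m`, i.e. every subspace invariant
under this preimage is `⊥` or `⊤`. -/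
def IsRegularHom {m : ℕ} {k : Type} [Field k] (ψ : A5 →* PGLmk m k) : Prop :=
  ∀ W : Submodule k (Fin m → k),
    (∀ g : GLmk m k, pglQuot m k g ∈ ψ.range →
      ∀ v ∈ W, Matrix.mulVec (g : Matrix (Fin m) (Fin m) k) v ∈ W) →
    W = ⊥ ∨ W = ⊤

/-- Two homomorphisms `ψ, ψ' : A₅ → PGL_m(k)` are conjugate if `ψ'` is obtained from `ψ`
by composing with an inner automorphism of `PGL_m(k)`. -/
def PGLConj {m : ℕ} {k : Type} [Field k] (ψ ψ' : A5 →* PGLmk m k) : Prop :=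
  ∃ y : PGLmk m k, ∀ x, ψ' x = y * ψ x * y⁻¹

/-- `ψ : A₅ → PGL_m(k)` lifts to `GL_m(k)` if it is of the form `π ∘ ρ` for a homomorphism
`ρ : A₅ → GL_m(k)`, where `π` is the quotient map. -/
def LiftsToGL {m : ℕ} {k : Type} [Field k] (ψ : A5 →* PGLmk m k) : Prop :=
  ∃ ρ : A5 →* GLmk m k, ∀ x, ψ x = pglQuot m k (ρ x)

/-! ### Diagonalisation of matrices of finite projective order -/

theorem diag_of_pow {k : Type} [Field k] [IsAlgClosed k] (n : ℕ) (hn : (n : k) ≠ 0)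
    (M : Matrix (Fin 4) (Fin 4) k) (c : k) (hc : c ≠ 0) (hM : M ^ n = c • 1) :
    ∃ P : Matrix.GeneralLinearGroup (Fin 4) k, ∃ d : Fin 4 → k,
      M * P.val = P.val * Matrix.diagonal d ∧ ∀ i, d i ^ n = c := by
  classical
  have hss : Module.End.IsSemisimple (Matrix.toLin' M) := by
    refine Module.End.isSemisimple_of_squarefree_aeval_eq_zero
      (p := Polynomial.X ^ n - Polynomial.C c)
      ((Polynomial.separable_X_pow_sub_C c hn hc).squarefree) ?_
    have h1 : (Matrix.toLin' M) ^ n = c • 1 := by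
      rw [← Matrix.toLin'_pow, hM]; simp [Module.End.one_eq_id]
    simp [h1, Algebra.smul_def]
  have htop : ⨆ μ : k, Module.End.eigenspace (Matrix.toLin' M) μ = ⊤ :=
    Module.End.IsSemisimple.iSup_eigenspace_eq_top hss
  set S : Set (Fin 4 → k) := {v | ∃ μ : k, M.mulVec v = μ • v} with hS
  have hspan : ⊤ ≤ Submodule.span k S := by
    rw [← htop]
    refine iSup_le fun μ v hv => Submodule.subset_span ⟨μ, ?_⟩
    simpa using Module.End.mem_eigenspace_iff.mp hv
  let b0 := Module.Basis.ofSpan hspan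
  let b := b0.reindex (b0.indexEquiv (Pi.basisFun k (Fin 4)))
  have hb : ∀ i, ∃ μ : k, M.mulVec (b i) = μ • b i := by
    intro i
    have : b i ∈ S := by
      apply Module.Basis.ofSpan_subset hspan
      exact ⟨(b0.indexEquiv (Pi.basisFun k (Fin 4))).symm i, by simp [b, b0]⟩
    exact this
  choose d hd using hb
  have hu : IsUnit ((Pi.basisFun k (Fin 4)).toMatrix b) := by
    have := (Pi.basisFun k (Fin 4)).invertibleToMatrix b
    exact isUnit_of_invertible _
  refine ⟨hu.unit, d, ?_, ?_⟩
  · ext i j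
    have := congrFun (hd j) i
    simpa [Matrix.mul_apply, Matrix.mulVec, dotProduct, Module.Basis.toMatrix_apply,
      Matrix.diagonal_apply, mul_comm] using this
  · intro i
    have h2 : ∀ m : ℕ, (M ^ m).mulVec (b i) = d i ^ m • b i := by
      intro m
      induction m with
      | zero => simp
      | succ m ih => rw [pow_succ', ← Matrix.mulVec_mulVec, ih, Matrix.mulVec_smul, hd, smul_smul,
          pow_succ]
    have h3 := h2 n
    rw [hM, Matrix.smul_mulVec, Matrix.one_mulVec] at h3
    have h4 : (c - d i ^ n) • b i = 0 := by rw [sub_smul, h3, sub_self]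
    rcases smul_eq_zero.mp h4 with h | h
    · exact (sub_eq_zero.mp h).symm
    · exact absurd h (b.ne_zero i)

/-! ### Generators and conjugacy classes of the alternating group -/

/-- The involution `(0 3)(1 4)`. -/
def ga : A5 := ⟨Equiv.swap 0 3 * Equiv.swap 1 4, Equiv.Perm.mem_alternatingGroup.mpr (by decide)⟩

/-- The 3-cycle `(0 1 2)`. -/
def gb : A5 := ⟨Equiv.swap 0 1 * Equiv.swap 1 2, Equiv.Perm.mem_alternatingGroup.mpr (by decide)⟩

theorem ga_sq : ga ^ 2 = 1 := by decide
theorem gb_cube : gb ^ 3 = 1 := by decide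
theorem gab_pow : (ga * gb) ^ 5 = 1 := by decide
theorem ga_ne : ga ≠ 1 := by decide
theorem gb_ne : gb ≠ 1 := by decide
theorem gab_ne : ga * gb ≠ 1 := by decide

theorem card_A5 : Nat.card A5 = 60 := by
  rw [nat_card_alternatingGroup, Nat.card_eq_fintype_card]; rfl

theorem closure_gen : Subgroup.closure ({ga, gb} : Set A5) = ⊤ := by
  set H := Subgroup.closure ({ga, gb} : Set A5)
  have ha : ga ∈ H := Subgroup.subset_closure (by simp)
  have hb : gb ∈ H := Subgroup.subset_closure (by simp)
  have h2 : orderOf ga = 2 := orderOf_eq_prime ga_sq ga_ne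
  have h3 : orderOf gb = 3 := orderOf_eq_prime gb_cube gb_ne
  have : Fact (Nat.Prime 5) := ⟨by norm_num⟩
  have h5 : orderOf (ga * gb) = 5 := orderOf_eq_prime gab_pow gab_ne
  have d2 : 2 ∣ Nat.card H := h2 ▸ Subgroup.orderOf_dvd_natCard H ha
  have d3 : 3 ∣ Nat.card H := h3 ▸ Subgroup.orderOf_dvd_natCard H hb
  have d5 : orderOf (ga * gb) ∣ Nat.card H := by
    exact Subgroup.orderOf_dvd_natCard H (H.mul_mem ha hb)
  rw [h5] at d5
  have hm := H.card_mul_index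
  rw [card_A5] at hm
  have hdvd : 30 ∣ Nat.card H := by omega
  obtain ⟨m, hm'⟩ := hdvd
  have hidx : H.index = 1 ∨ H.index = 2 := by
    rw [hm'] at hm
    have h : m * H.index = 2 := by
      have : 30 * (m * H.index) = 30 * 2 := by rw [← mul_assoc, hm]
      omega
    exact (Nat.dvd_prime Nat.prime_two).mp ⟨m, by rw [← h, mul_comm]⟩
  rcases hidx with h | h
  · exact Subgroup.index_eq_one.mp h
  · have hn : H.Normal := Subgroup.normal_of_index_eq_two h
    rcases hn.eq_bot_or_eq_top with h' | h'
    · rw [h'] at d2; simp at d2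
    · exact h'

theorem hom_ext_gen {G : Type*} [Group G] (f g : A5 →* G) (ha : f ga = g ga) (hb : f gb = g gb) :
    f = g := by
  refine MonoidHom.eq_of_eqOn_dense closure_gen ?_
  intro x hx
  rcases hx with rfl | rfl
  · exact ha
  · exact hb

theorem gb_conj_inv : ∃ y : A5, y * gb * y⁻¹ = gb⁻¹ := by decide

theorem gab_conj_inv : ∃ y : A5, y * (ga * gb) * y⁻¹ = (ga * gb)⁻¹ := by decide

/-- Representatives of the conjugacy classes of `A₅`. -/
def rep5 : Fin 5 → A5 := ![1, ga, gb, ga * gb, (ga * gb) ^ 2]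

/-- The label of the conjugacy class of an element of `A₅`. -/
def cls5 (x : A5) : Fin 5 :=
  if x = 1 then 0 else if x * x = 1 then 1 else if x * x * x = 1 then 2 else
    if ∃ y : A5, y * (ga * gb) * y⁻¹ = x then 3 else 4

set_option maxRecDepth 100000 in
theorem conj_rep5 : ∀ x : A5, ∃ y : A5, y * rep5 (cls5 x) * y⁻¹ = x := by decide +kernel

set_option maxRecDepth 100000 in
theorem card_cls5 : ∀ i : Fin 5, (Finset.univ.filter fun x : A5 => cls5 x = i).card =
    (![1, 15, 20, 12, 12] : Fin 5 → ℕ) i := by decide +kernel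

theorem class_sum {k : Type} [Field k] (φ : A5 → k) (h : ∀ x y : A5, φ (y * x * y⁻¹) = φ x) :
    ∑ x, φ x = φ 1 + 15 * φ ga + 20 * φ gb + 12 * φ (ga * gb) + 12 * φ ((ga * gb) ^ 2) := by
  have h1 : ∀ x, φ x = φ (rep5 (cls5 x)) := by
    intro x
    obtain ⟨y, hy⟩ := conj_rep5 x
    conv_lhs => rw [← hy]
    exact h _ _
  have h2 : ∑ x, φ x = ∑ i : Fin 5, ((![1, 15, 20, 12, 12] : Fin 5 → ℕ) i : k) * φ (rep5 i) := by
    rw [Finset.sum_congr rfl fun x _ => h1 x, ← Finset.sum_fiberwise (g := cls5)]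
    refine Finset.sum_congr rfl fun i _ => ?_
    rw [← card_cls5 i, ← nsmul_eq_mul]
    refine Finset.sum_eq_card_nsmul fun x hx => ?_
    rw [(Finset.mem_filter.mp hx).2]
  rw [h2, Fin.sum_univ_five]
  simp [rep5]

/-! ### Schur lemma and the norm of the character -/

theorem pgl_eq_iff {k : Type} [Field k] (g h : GLmk 4 k) :
    pglQuot 4 k g = pglQuot 4 k h ↔ ∃ s : k, s ≠ 0 ∧ g.val = s • h.val := by
  have h0 : pglQuot 4 k g = pglQuot 4 k h ↔ h⁻¹ * g ∈ Subgroup.center (GLmk 4 k) := by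
    rw [eq_comm]
    exact QuotientGroup.eq
  rw [h0, Matrix.GeneralLinearGroup.mem_center_iff_val_mem_range_scalar]
  constructor
  · rintro ⟨s, hs⟩
    have h1 : g.val = s • h.val := by
      have h2 : g.val = h.val * (h⁻¹ * g).val := by
        rw [← Units.val_mul, mul_inv_cancel_left]
      rw [h2, ← hs, Matrix.scalar_apply, ← Matrix.smul_one_eq_diagonal, mul_smul_comm, mul_one]
    refine ⟨s, ?_, h1⟩
    rintro rfl
    rw [zero_smul] at h1
    exact g.ne_zero h1
  · rintro ⟨s, -, hs⟩
    refine ⟨s, ?_⟩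
    rw [Units.val_mul, hs, mul_smul_comm, ← Units.val_mul, inv_mul_cancel, Units.val_one,
      Matrix.scalar_apply, ← Matrix.smul_one_eq_diagonal]

theorem pglQuot_surj {k : Type} [Field k] (y : PGLmk 4 k) : ∃ g, pglQuot 4 k g = y :=
  QuotientGroup.mk_surjective y

theorem pglQuot_one_iff {k : Type} [Field k] (g : GLmk 4 k) :
    pglQuot 4 k g = 1 ↔ ∃ s : k, s ≠ 0 ∧ g.val = s • 1 := by
  rw [← map_one (pglQuot 4 k), pgl_eq_iff]; rfl

theorem schur {k : Type} [Field k] [IsAlgClosed k] {ψ : A5 →* PGLmk 4 k} (hψ : IsRegularHom ψ)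
    (M : Matrix (Fin 4) (Fin 4) k)
    (hM : ∀ g : GLmk 4 k, pglQuot 4 k g ∈ ψ.range → g.val * M = M * g.val) :
    ∃ s : k, M = s • 1 := by
  obtain ⟨s, hs⟩ := Module.End.exists_eigenvalue (Matrix.toLin' M)
  refine ⟨s, ?_⟩
  have h1 := hψ (Module.End.eigenspace (Matrix.toLin' M) s) (by
    intro g hg v hv
    rw [Module.End.mem_eigenspace_iff, Matrix.toLin'_apply] at hv ⊢
    rw [Matrix.mulVec_mulVec, ← hM g hg, ← Matrix.mulVec_mulVec, hv, Matrix.mulVec_smul])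
  rcases h1 with h1 | h1
  · exact absurd h1 hs
  · ext i j
    have h2 : (Pi.single j 1 : Fin 4 → k) ∈ Module.End.eigenspace (Matrix.toLin' M) s := by
      rw [h1]; trivial
    rw [Module.End.mem_eigenspace_iff, Matrix.toLin'_apply] at h2
    have h3 := congrFun h2 i
    simpa [Matrix.one_apply, Pi.single_apply] using h3

/-- A chosen lift of `ψ x`. -/
noncomputable def lift {k : Type} [Field k] (ψ : A5 →* PGLmk 4 k) (x : A5) : GLmk 4 k :=
  (pglQuot_surj (ψ x)).choose

theorem lift_spec {k : Type} [Field k] (ψ : A5 →* PGLmk 4 k) (x : A5) :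
    pglQuot 4 k (lift ψ x) = ψ x := (pglQuot_surj (ψ x)).choose_spec

/-- The squared absolute value of the character of a projective representation. -/
noncomputable def nchar {k : Type} [Field k] (ψ : A5 →* PGLmk 4 k) (x : A5) : k :=
  (lift ψ x).val.trace * (lift ψ x)⁻¹.val.trace

theorem inv_val_smul {k : Type} [Field k] {g h : GLmk 4 k} {s : k} (hs0 : s ≠ 0)
    (hs : g.val = s • h.val) : g⁻¹.val = s⁻¹ • h⁻¹.val := by
  have h3 : g⁻¹.val * g.val = 1 := by rw [← Units.val_mul, inv_mul_cancel, Units.val_one]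
  have h4 : h.val * h⁻¹.val = 1 := by rw [← Units.val_mul, mul_inv_cancel, Units.val_one]
  rw [hs, mul_smul_comm] at h3
  calc g⁻¹.val = g⁻¹.val * (h.val * h⁻¹.val) := by rw [h4, mul_one]
    _ = s⁻¹ • ((s • (g⁻¹.val * h.val)) * h⁻¹.val) := by
      rw [smul_mul_assoc, smul_smul, inv_mul_cancel₀ hs0, one_smul, mul_assoc]
    _ = _ := by rw [h3, one_mul]

theorem conj_eq_of_quot {k : Type} [Field k] {g h : GLmk 4 k}
    (e : pglQuot 4 k g = pglQuot 4 k h) (M : Matrix (Fin 4) (Fin 4) k) :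
    g.val * M * g⁻¹.val = h.val * M * h⁻¹.val := by
  obtain ⟨s, hs0, hs⟩ := (pgl_eq_iff g h).mp e
  rw [inv_val_smul hs0 hs, hs]
  simp [smul_smul, inv_mul_cancel₀ hs0]

theorem trace_mul_of_quot {k : Type} [Field k] {g h : GLmk 4 k}
    (e : pglQuot 4 k g = pglQuot 4 k h) :
    g.val.trace * g⁻¹.val.trace = h.val.trace * h⁻¹.val.trace := by
  obtain ⟨s, hs0, hs⟩ := (pgl_eq_iff g h).mp e
  rw [inv_val_smul hs0 hs, hs, Matrix.trace_smul, Matrix.trace_smul]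
  simp only [smul_eq_mul]
  field_simp

theorem nchar_eq {k : Type} [Field k] (ψ : A5 →* PGLmk 4 k) (x : A5) (g : GLmk 4 k)
    (hg : pglQuot 4 k g = ψ x) : nchar ψ x = g.val.trace * g⁻¹.val.trace :=
  trace_mul_of_quot ((lift_spec ψ x).trans hg.symm)

theorem nchar_conj {k : Type} [Field k] (ψ : A5 →* PGLmk 4 k) (x y : A5) :
    nchar ψ (y * x * y⁻¹) = nchar ψ x := by
  rw [nchar_eq ψ (y * x * y⁻¹) (lift ψ y * lift ψ x * (lift ψ y)⁻¹) (by simp [lift_spec]), nchar]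
  congr 1
  · rw [Units.val_mul, Matrix.trace_mul_comm, ← Units.val_mul, inv_mul_cancel_left]
  · rw [mul_inv_rev, mul_inv_rev, inv_inv, Units.val_mul, Matrix.trace_mul_comm, ← Units.val_mul,
      mul_assoc, inv_mul_cancel, mul_one]

theorem sum_nchar {k : Type} [Field k] [IsAlgClosed k] (h4 : (4 : k) ≠ 0) {ψ : A5 →* PGLmk 4 k}
    (hψ : IsRegularHom ψ) : ∑ x, nchar ψ x = 60 := by
  set Φ : Matrix (Fin 4) (Fin 4) k → Matrix (Fin 4) (Fin 4) k :=
    fun M => ∑ x, (lift ψ x).val * M * (lift ψ x)⁻¹.val with hΦ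
  have hcomm : ∀ M, ∀ g : GLmk 4 k, pglQuot 4 k g ∈ ψ.range → g.val * Φ M = Φ M * g.val := by
    rintro M g ⟨y, hy⟩
    have h1 : g.val * Φ M * g⁻¹.val = Φ M := by
      simp only [hΦ, Finset.mul_sum, Finset.sum_mul]
      refine Fintype.sum_equiv (Equiv.mulLeft y) _ _ fun x => ?_
      have h2 : pglQuot 4 k (g * lift ψ x) = pglQuot 4 k (lift ψ (y * x)) := by
        rw [map_mul, lift_spec, lift_spec, map_mul, hy]
      have h3 := conj_eq_of_quot h2 M
      rw [Equiv.coe_mulLeft, ← h3, mul_inv_rev, Units.val_mul, Units.val_mul]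
      simp only [mul_assoc]
    calc g.val * Φ M = g.val * Φ M * (g⁻¹.val * g.val) := by
          rw [← Units.val_mul, inv_mul_cancel, Units.val_one, mul_one]
      _ = _ := by rw [← mul_assoc, h1]
  have hcard : (Fintype.card A5 : k) = 60 := by
    rw [← Nat.card_eq_fintype_card, card_A5]; norm_num
  have htr : ∀ M, (Φ M).trace = 60 * M.trace := by
    intro M
    simp only [hΦ, Matrix.trace_sum]
    rw [Finset.sum_congr rfl (g := fun _ => M.trace)]
    · rw [Finset.sum_const, nsmul_eq_mul, Finset.card_univ, hcard]
    · intro x _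
      rw [Matrix.trace_mul_comm, ← mul_assoc, ← Units.val_mul, inv_mul_cancel, Units.val_one,
        one_mul]
  have hΦ' : ∀ M, Φ M = (15 * M.trace) • 1 := by
    intro M
    obtain ⟨s, hs⟩ := schur hψ (Φ M) (hcomm M)
    have h1 := htr M
    rw [hs, Matrix.trace_smul, Matrix.trace_one, Fintype.card_fin, smul_eq_mul] at h1
    rw [hs]
    congr 1
    apply mul_right_cancel₀ h4
    push_cast at h1
    linear_combination h1
  have key : ∀ i j, ∑ x, (lift ψ x).val i i * (lift ψ x)⁻¹.val j j = if i = j then 15 else 0 := by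
    intro i j
    have h1 := congrFun (congrFun (hΦ' (Matrix.single i j 1)) i) j
    rw [hΦ] at h1
    simp only [Matrix.sum_apply] at h1
    have h2 : ∀ x, ((lift ψ x).val * Matrix.single i j (1 : k) * (lift ψ x)⁻¹.val : Matrix (Fin 4) (Fin 4) k) i j =
        (lift ψ x).val i i * (lift ψ x)⁻¹.val j j := by
      intro x
      rw [Matrix.mul_apply, Finset.sum_eq_single j]
      · simp
      · intro l _ hl
        rw [Matrix.mul_single_apply_of_ne (hbj := hl), zero_mul]
      · simp
    rw [Finset.sum_congr rfl fun x _ => h2 x] at h1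
    rw [h1]
    by_cases hij : i = j
    · subst hij; simp
    · simp [hij]
  have : ∑ x, nchar ψ x = ∑ i, ∑ j, ∑ x, (lift ψ x).val i i * (lift ψ x)⁻¹.val j j := by
    simp only [nchar, Matrix.trace, Matrix.diag, Finset.sum_mul_sum]
    rw [Finset.sum_comm]
    refine Finset.sum_congr rfl fun i _ => ?_
    rw [Finset.sum_comm]
  rw [this]
  simp only [key]
  simp
  norm_num

theorem regular_injective {k : Type} [Field k] {ψ : A5 →* PGLmk 4 k} (hψ : IsRegularHom ψ) :
    Function.Injective ψ := by
  rw [← MonoidHom.ker_eq_bot_iff]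
  rcases (inferInstance : ψ.ker.Normal).eq_bot_or_eq_top with h | h
  · exact h
  · exfalso
    have h1 := hψ (Submodule.span k {Pi.single 0 1}) (by
      rintro g ⟨x, hx⟩ v hv
      have h2 : x ∈ ψ.ker := by rw [h]; trivial
      rw [MonoidHom.mem_ker.mp h2] at hx
      obtain ⟨s, -, hs⟩ := (pglQuot_one_iff g).mp hx.symm
      rw [hs, Matrix.smul_mulVec, Matrix.one_mulVec]
      exact Submodule.smul_mem _ _ hv)
    rcases h1 with h1 | h1
    · rw [Submodule.span_singleton_eq_bot] at h1
      simpa using congrFun h1 0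
    · have h2 : (Pi.single 1 1 : Fin 4 → k) ∈ Submodule.span k {(Pi.single 0 1 : Fin 4 → k)} := by
        rw [h1]; trivial
      obtain ⟨c, hc⟩ := Submodule.mem_span_singleton.mp h2
      simpa using congrFun hc 1

/-! ### Eigenvalue multisets -/

theorem exists_perm_of_map_eq {α : Type*} [DecidableEq α] (f g : Fin 4 → α)
    (h : Finset.univ.val.map f = Finset.univ.val.map g) :
    ∃ σ : Equiv.Perm (Fin 4), ∀ i, g (σ i) = f i := by
  have h1 : ∀ c, Fintype.card {a // f a = c} = Fintype.card {b // g b = c} := by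
    intro c
    have h2 := congrArg (Multiset.count c) h
    rw [Multiset.count_map, Multiset.count_map] at h2
    rw [Fintype.card_subtype, Fintype.card_subtype, Finset.card_def, Finset.card_def,
      Finset.filter_val, Finset.filter_val]
    simpa [eq_comm] using h2
  exact ⟨Equiv.ofFiberEquiv fun c => Fintype.equivOfCardEq (h1 c),
    fun i => Equiv.ofFiberEquiv_map _ i⟩

/-- `M` is diagonalisable with eigenvalues `d`. -/
def DiagBy {k : Type} [Field k] (M : Matrix (Fin 4) (Fin 4) k) (d : Fin 4 → k) : Prop :=
  ∃ P : GLmk 4 k, M * P.val = P.val * Matrix.diagonal d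

theorem DiagBy.reorder {k : Type} [Field k] {M : Matrix (Fin 4) (Fin 4) k} {d : Fin 4 → k}
    (h : DiagBy M d) (σ : Equiv.Perm (Fin 4)) : DiagBy M (fun i => d (σ i)) := by
  obtain ⟨P, hP⟩ := h
  have hu : IsUnit (P.val.submatrix id σ) := by
    rw [Matrix.isUnit_iff_isUnit_det]
    have := (Matrix.isUnit_iff_isUnit_det _).mp P.isUnit
    rw [Matrix.det_permute']
    refine IsUnit.mul ?_ this
    rcases Int.units_eq_one_or (Equiv.Perm.sign σ) with h | h <;> simp [h]
  refine ⟨hu.unit, ?_⟩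
  ext i j
  have h2 := congrFun (congrFun hP i) (σ j)
  simpa [Matrix.mul_apply, Matrix.diagonal_apply] using h2

theorem DiagBy.eq {k : Type} [Field k] {M : Matrix (Fin 4) (Fin 4) k} {d : Fin 4 → k}
    (h : DiagBy M d) : ∃ P : GLmk 4 k, M = P.val * Matrix.diagonal d * P⁻¹.val := by
  obtain ⟨P, hP⟩ := h
  refine ⟨P, ?_⟩
  rw [← hP, mul_assoc, ← Units.val_mul, mul_inv_cancel, Units.val_one, mul_one]

theorem DiagBy.trace {k : Type} [Field k] {M : Matrix (Fin 4) (Fin 4) k} {d : Fin 4 → k}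
    (h : DiagBy M d) : M.trace = d 0 + d 1 + d 2 + d 3 := by
  obtain ⟨P, hP⟩ := h.eq
  rw [hP, Matrix.trace_mul_comm, ← mul_assoc, ← Units.val_mul, inv_mul_cancel, Units.val_one,
    one_mul, Matrix.trace_diagonal, Fin.sum_univ_four]

theorem DiagBy.det {k : Type} [Field k] {M : Matrix (Fin 4) (Fin 4) k} {d : Fin 4 → k}
    (h : DiagBy M d) : M.det = d 0 * d 1 * d 2 * d 3 := by
  obtain ⟨P, hP⟩ := h
  have h1 := congrArg Matrix.det hP
  rw [Matrix.det_mul, Matrix.det_mul, Matrix.det_diagonal, mul_comm] at h1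
  have h2 := ((Matrix.isUnit_iff_isUnit_det _).mp P.isUnit).ne_zero
  rw [mul_left_cancel₀ h2 h1, Fin.prod_univ_four]

theorem DiagBy.mul_self {k : Type} [Field k] {M : Matrix (Fin 4) (Fin 4) k} {d : Fin 4 → k}
    (h : DiagBy M d) : DiagBy (M * M) (fun i => d i * d i) := by
  obtain ⟨P, hP⟩ := h
  refine ⟨P, ?_⟩
  rw [mul_assoc, hP, ← mul_assoc, hP, mul_assoc, Matrix.diagonal_mul_diagonal]

theorem DiagBy.inv {k : Type} [Field k] {M : GLmk 4 k} {d e : Fin 4 → k}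
    (h : DiagBy M.val d) (he : ∀ i, d i * e i = 1) : DiagBy M⁻¹.val e := by
  obtain ⟨P, hP⟩ := h
  refine ⟨P, ?_⟩
  have h1 : Matrix.diagonal d * Matrix.diagonal e = 1 := by
    rw [Matrix.diagonal_mul_diagonal]
    simp [he]
  calc M⁻¹.val * P.val = M⁻¹.val * (P.val * (Matrix.diagonal d * Matrix.diagonal e)) := by
        rw [h1, mul_one]
    _ = M⁻¹.val * M.val * P.val * Matrix.diagonal e := by
        rw [← mul_assoc P.val, ← hP]; simp only [mul_assoc]
    _ = _ := by rw [← Units.val_mul, inv_mul_cancel, Units.val_one, one_mul]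

theorem charpoly_conj_GL {k : Type} [Field k] (P : GLmk 4 k) (N : Matrix (Fin 4) (Fin 4) k) :
    (P.val * N * P⁻¹.val).charpoly = N.charpoly := by
  rw [Matrix.charpoly_mul_comm, ← mul_assoc, ← Units.val_mul, inv_mul_cancel, Units.val_one,
    one_mul]

theorem DiagBy.roots {k : Type} [Field k] {M : Matrix (Fin 4) (Fin 4) k} {d : Fin 4 → k}
    (h : DiagBy M d) : M.charpoly.roots = Finset.univ.val.map d := by
  obtain ⟨P, hP⟩ := h.eq
  have h1 : M.charpoly = (Matrix.diagonal d).charpoly := by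
    rw [hP]; exact charpoly_conj_GL P _
  rw [h1, Matrix.charpoly_diagonal]
  have := Polynomial.roots_multiset_prod_X_sub_C (Finset.univ.val.map d)
  rw [Multiset.map_map] at this
  exact this

theorem DiagBy.const {k : Type} [Field k] {M : Matrix (Fin 4) (Fin 4) k} {c : k}
    (h : DiagBy M (fun _ => c)) : M = c • 1 := by
  obtain ⟨P, hP⟩ := h.eq
  rw [hP, ← Matrix.smul_one_eq_diagonal, mul_smul_comm, mul_one, smul_mul_assoc, ← Units.val_mul,
    mul_inv_cancel, Units.val_one]

/-- Exponent form of the eigenvalues. -/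
theorem diag_exp {k : Type} [Field k] [IsAlgClosed k] (n : ℕ) [NeZero n] (hn : (n : k) ≠ 0)
    {ζ : k} (hζ : IsPrimitiveRoot ζ n) (M : Matrix (Fin 4) (Fin 4) k) (μ : k) (hμ : μ ≠ 0)
    (hM : M ^ n = μ ^ n • 1) :
    ∃ e : Fin 4 → Fin n, DiagBy M (fun i => μ * ζ ^ (e i).val) := by
  obtain ⟨P, d, hP, hd⟩ := diag_of_pow n hn M (μ ^ n) (pow_ne_zero _ hμ) hM
  have h1 : ∀ i, ∃ e : Fin n, d i = μ * ζ ^ e.val := by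
    intro i
    obtain ⟨j, hj, hj'⟩ := hζ.eq_pow_of_pow_eq_one (ξ := d i / μ) (by
      rw [div_pow, hd, div_self (pow_ne_zero _ hμ)])
    exact ⟨⟨j, hj⟩, by rw [hj', mul_div_cancel₀ _ hμ]⟩
  choose e he using h1
  refine ⟨e, P, ?_⟩
  rw [hP]
  congr 2
  funext i
  exact he i

/-- Elements of `A₅` conjugate to their inverse have self-dual lifts. -/
theorem charpoly_inv_eq {k : Type} [Field k] (ψ : A5 →* PGLmk 4 k) (x y : A5)
    (hy : y * x * y⁻¹ = x⁻¹) (C : GLmk 4 k) (hC : pglQuot 4 k C = ψ x) (n : ℕ)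
    (hn : C ^ n = 1) (hdet : C.val.det = 1) (hcop : Nat.Coprime n 4) :
    C⁻¹.val.charpoly = C.val.charpoly := by
  obtain ⟨Y, hY⟩ := pglQuot_surj (ψ y)
  have h1 : pglQuot 4 k (Y * C * Y⁻¹) = pglQuot 4 k C⁻¹ := by
    rw [map_mul, map_mul, map_inv, map_inv, hY, hC, ← map_inv, ← map_inv, ← map_mul, ← map_mul, hy]
  obtain ⟨s, hs0, hs⟩ := (pgl_eq_iff _ _).mp h1
  have hsn : s ^ n = 1 := by
    have h2 : (Y * C * Y⁻¹) ^ n = 1 := by rw [conj_pow, hn]; simp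
    have h3 := congrArg Units.val h2
    rw [Units.val_pow_eq_pow_val, hs, smul_pow, ← Units.val_pow_eq_pow_val, inv_pow, hn, inv_one,
      Units.val_one] at h3
    have h4 := congrFun (congrFun h3 0) 0
    simpa using h4
  have hs4 : s ^ 4 = 1 := by
    have h3 := congrArg Matrix.det hs
    have h5 : C⁻¹.val.det = 1 := by
      have h6 : C⁻¹.val.det * C.val.det = 1 := by
        rw [← Matrix.det_mul, ← Units.val_mul, inv_mul_cancel, Units.val_one, Matrix.det_one]
      rwa [hdet, mul_one] at h6
    have h7 : Y.val.det * Y⁻¹.val.det = 1 := by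
      rw [← Matrix.det_mul, ← Units.val_mul, mul_inv_cancel, Units.val_one, Matrix.det_one]
    rw [Matrix.det_smul, h5, Units.val_mul, Units.val_mul, Matrix.det_mul, Matrix.det_mul, hdet,
      mul_one, h7] at h3
    simpa using h3.symm
  have hs1 : s = 1 := by
    have h8 : orderOf s ∣ Nat.gcd n 4 :=
      Nat.dvd_gcd (orderOf_dvd_of_pow_eq_one hsn) (orderOf_dvd_of_pow_eq_one hs4)
    rw [hcop.gcd_eq_one, Nat.dvd_one, orderOf_eq_one_iff] at h8
    exact h8
  rw [hs1, one_smul] at hs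
  rw [← hs]
  rw [Units.val_mul, Units.val_mul]
  exact charpoly_conj_GL Y _

theorem self_dual_exp {k : Type} [Field k] (n : ℕ) [NeZero n] {ζ : k} (hζ : IsPrimitiveRoot ζ n)
    (C : GLmk 4 k) (e : Fin 4 → Fin n) (h : DiagBy C.val (fun i => ζ ^ (e i).val))
    (hc : C⁻¹.val.charpoly = C.val.charpoly) :
    Finset.univ.val.map e = Finset.univ.val.map fun i => - e i := by
  have hval : ∀ j : Fin n, ζ ^ j.val * ζ ^ (-j).val = 1 := by
    intro j
    rw [← pow_add, hζ.pow_eq_one_iff_dvd, Fin.val_neg']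
    rcases Nat.eq_zero_or_pos j.val with h0 | h0
    · simp [h0]
    · rw [Nat.mod_eq_of_lt (by omega)]
      have := j.isLt
      exact ⟨1, by omega⟩
  have h1 := (h.inv (e := fun i => ζ ^ (-e i).val) (fun i => hval _)).roots
  rw [hc, h.roots] at h1
  have hinj : Function.Injective (fun j : Fin n => ζ ^ j.val) := by
    intro a b hab
    exact Fin.ext (hζ.pow_inj a.isLt b.isLt hab)
  apply Multiset.map_injective hinj
  rw [Multiset.map_map, Multiset.map_map]
  exact h1

theorem DiagBy.of_map_eq {k : Type} [Field k] {n : ℕ} {M : Matrix (Fin 4) (Fin 4) k}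
    {e f : Fin 4 → Fin n} (F : Fin n → k) (h : DiagBy M (fun i => F (e i)))
    (hef : Finset.univ.val.map f = Finset.univ.val.map e) : DiagBy M (fun i => F (f i)) := by
  obtain ⟨σ, hσ⟩ := exists_perm_of_map_eq f e hef
  have := h.reorder σ
  simpa [hσ] using this

theorem exps_two (e : Fin 4 → Fin 2) : ∃ f ∈ [![0, 0, 0, 0], ![0, 0, 0, 1], ![0, 0, 1, 1],
    ![0, 1, 1, 1], ![1, 1, 1, 1]], Finset.univ.val.map f = Finset.univ.val.map e := by
  revert e; decide

theorem exps_three (e : Fin 4 → Fin 3)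
    (h : Finset.univ.val.map e = Finset.univ.val.map fun i => - e i) :
    ∃ f ∈ [![0, 0, 0, 0], ![0, 0, 1, 2], ![1, 1, 2, 2]],
      Finset.univ.val.map f = Finset.univ.val.map e := by
  revert e; decide +kernel

theorem exps_five (e : Fin 4 → Fin 5)
    (h : Finset.univ.val.map e = Finset.univ.val.map fun i => - e i) :
    ∃ f ∈ [![0, 0, 0, 0], ![0, 0, 1, 4], ![0, 0, 2, 3], ![1, 1, 4, 4], ![2, 2, 3, 3],
      ![1, 2, 3, 4]], Finset.univ.val.map f = Finset.univ.val.map e := by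
  revert e; decide +kernel

/-! ### Normalised lifts and their eigenvalues -/

/-- Normalised lifts of the two generators. -/
structure NormLift {k : Type} [Field k] (ψ : A5 →* PGLmk 4 k) (A B : GLmk 4 k) (l : k) : Prop where
  ha : pglQuot 4 k A = ψ ga
  hb : pglQuot 4 k B = ψ gb
  hA : A.val ^ 2 = l • 1
  hB : B ^ 3 = 1
  hC : (A * B) ^ 5 = 1
  dA : A.val.det = 1
  dB : B.val.det = 1

theorem exists_lift_det {k : Type} [Field k] [IsAlgClosed k] (y : PGLmk 4 k) :
    ∃ g : GLmk 4 k, pglQuot 4 k g = y ∧ g.val.det = 1 := by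
  obtain ⟨g, hg⟩ := pglQuot_surj y
  have hd : g.val.det ≠ 0 := ((Matrix.isUnit_iff_isUnit_det _).mp g.isUnit).ne_zero
  obtain ⟨t, ht⟩ := IsAlgClosed.exists_pow_nat_eq (g.val.det)⁻¹ (n := 4) (by norm_num)
  have ht0 : t ≠ 0 := by
    rintro rfl
    simp at ht
    exact hd ht.symm
  have hdet : (t • g.val).det = 1 := by
    rw [Matrix.det_smul, Fintype.card_fin, ht, inv_mul_cancel₀ hd]
  have hu : IsUnit (t • g.val) := by
    rw [Matrix.isUnit_iff_isUnit_det, hdet]; exact isUnit_one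
  refine ⟨hu.unit, ?_, hdet⟩
  rw [← hg, pgl_eq_iff]
  exact ⟨t, ht0, rfl⟩

theorem exists_lift_pow {k : Type} [Field k] [IsAlgClosed k] (y : PGLmk 4 k) (n m : ℕ)
    (hy : y ^ n = 1) (hm : ∀ s : k, s ^ 4 = 1 → (s ^ m) ^ n * s = 1) :
    ∃ g : GLmk 4 k, pglQuot 4 k g = y ∧ g.val.det = 1 ∧ g ^ n = 1 := by
  obtain ⟨g, hg, hd⟩ := exists_lift_det y
  have h1 : pglQuot 4 k (g ^ n) = 1 := by rw [map_pow, hg, hy]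
  obtain ⟨s, hs0, hs⟩ := (pglQuot_one_iff _).mp h1
  have hs4 : s ^ 4 = 1 := by
    have h2 := congrArg Matrix.det hs
    rw [Units.val_pow_eq_pow_val, Matrix.det_pow, hd, one_pow, Matrix.det_smul, Matrix.det_one,
      mul_one, Fintype.card_fin] at h2
    exact h2.symm
  have hdet : (s ^ m • g.val).det = 1 := by
    rw [Matrix.det_smul, Fintype.card_fin, hd, mul_one, ← pow_mul, mul_comm, pow_mul, hs4, one_pow]
  have hu : IsUnit (s ^ m • g.val) := by
    rw [Matrix.isUnit_iff_isUnit_det, hdet]; exact isUnit_one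
  refine ⟨hu.unit, ?_, hdet, ?_⟩
  · rw [← hg, pgl_eq_iff]
    exact ⟨s ^ m, pow_ne_zero _ hs0, rfl⟩
  · apply Units.ext
    rw [Units.val_pow_eq_pow_val, IsUnit.unit_spec, smul_pow, ← Units.val_pow_eq_pow_val, hs,
      smul_smul, hm s hs4, one_smul, Units.val_one]

theorem exists_normLift {k : Type} [Field k] [IsAlgClosed k] (ψ : A5 →* PGLmk 4 k) :
    ∃ A B l, NormLift ψ A B l := by
  obtain ⟨B, hb, dB, hB⟩ := exists_lift_pow (ψ gb) 3 1 (by rw [← map_pow, gb_cube, map_one])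
    (fun s hs => by rw [← hs]; ring)
  obtain ⟨C, hc, dC, hC⟩ := exists_lift_pow (ψ (ga * gb)) 5 3
    (by rw [← map_pow, gab_pow, map_one])
    (fun s hs => by
      have : (s ^ 3) ^ 5 * s = (s ^ 4) ^ 4 := by ring
      rw [this, hs, one_pow])
  have ha : pglQuot 4 k (C * B⁻¹) = ψ ga := by
    rw [map_mul, map_inv, hc, hb, ← map_inv, ← map_mul, mul_inv_cancel_right]
  have h1 : pglQuot 4 k ((C * B⁻¹) ^ 2) = 1 := by rw [map_pow, ha, ← map_pow, ga_sq, map_one]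
  obtain ⟨l, -, hl⟩ := (pglQuot_one_iff _).mp h1
  refine ⟨C * B⁻¹, B, l, ha, hb, by rw [← hl, Units.val_pow_eq_pow_val], hB,
    by rw [inv_mul_cancel_right, hC], ?_, dB⟩
  have h2 : (C * B⁻¹).val.det * B.val.det = 1 := by
    rw [← Matrix.det_mul, ← Units.val_mul, inv_mul_cancel_right, dC]
  rwa [dB, mul_one] at h2

theorem not_scalar {k : Type} [Field k] {ψ : A5 →* PGLmk 4 k} (hψ : IsRegularHom ψ)
    {x : A5} (hx : x ≠ 1) {g : GLmk 4 k} (hg : pglQuot 4 k g = ψ x) {c : k}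
    (h : DiagBy g.val (fun _ => c)) : False := by
  have h1 := h.const
  apply hx
  apply regular_injective hψ
  rw [map_one, ← hg, pglQuot_one_iff]
  refine ⟨c, ?_, h1⟩
  rintro rfl
  rw [zero_smul] at h1
  exact g.ne_zero h1

theorem prim3 {k : Type} [Field k] {ω : k} (h : IsPrimitiveRoot ω 3) : 1 + ω + ω ^ 2 = 0 := by
  have := h.geom_sum_eq_zero (by norm_num)
  simpa [Finset.sum_range_succ] using this

theorem prim5 {k : Type} [Field k] {ζ : k} (h : IsPrimitiveRoot ζ 5) :
    1 + ζ + ζ ^ 2 + ζ ^ 3 + ζ ^ 4 = 0 := by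
  have := h.geom_sum_eq_zero (by norm_num)
  simpa [Finset.sum_range_succ] using this

/-- The possible values of the character on involutions. -/
theorem local_A {k : Type} [Field k] [IsAlgClosed k] (h2 : (2 : k) ≠ 0)
    {ψ : A5 →* PGLmk 4 k} (hψ : IsRegularHom ψ) {A B : GLmk 4 k} {l : k} (N : NormLift ψ A B l)
    {μ : k} (hμ : μ ^ 2 = l) :
    nchar ψ ga = 4 ∨ (nchar ψ ga = 0 ∧
      DiagBy A.val (fun i => μ * (-1) ^ ((![0, 0, 1, 1] : Fin 4 → Fin 2) i).val)) := by
  have hl : l ≠ 0 := by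
    rintro rfl
    have h3 := N.hA
    rw [zero_smul, ← Units.val_pow_eq_pow_val] at h3
    exact (A ^ 2).ne_zero h3
  have hμ0 : μ ≠ 0 := by rintro rfl; apply hl; rw [← hμ]; ring
  have hprim : IsPrimitiveRoot (-1 : k) 2 := by
    have hne : (-1 : k) ≠ 1 := fun h => h2 (by linear_combination -h)
    exact IsPrimitiveRoot.mk_of_lt _ (by norm_num) (by norm_num) (fun m h0 h1 => by
      interval_cases m; simpa using hne)
  obtain ⟨e, he⟩ := diag_exp 2 (by exact_mod_cast h2) hprim A.val μ hμ0 (by rw [N.hA, hμ])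
  obtain ⟨f, hf, hfe⟩ := exps_two e
  have hD : DiagBy A.val (fun i => μ * (-1) ^ (f i).val) :=
    he.of_map_eq (F := fun j => μ * (-1) ^ j.val) hfe
  have hI : DiagBy A⁻¹.val (fun i => μ⁻¹ * (-1) ^ (f i).val) := hD.inv (fun i => by
    have : ((-1 : k) ^ (f i).val) * (-1) ^ (f i).val = 1 := by rw [← mul_pow]; simp
    rw [mul_mul_mul_comm, mul_inv_cancel₀ hμ0, this, one_mul])
  have hn := nchar_eq ψ ga A N.ha
  rw [hD.trace, hI.trace] at hn
  simp only [List.mem_cons, List.not_mem_nil, or_false] at hf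
  rcases hf with rfl | rfl | rfl | rfl | rfl
  · exfalso
    refine not_scalar hψ ga_ne N.ha (c := μ) ?_
    convert hD using 2 with i
    fin_cases i <;> simp
  · left; rw [hn]; simp; field_simp; norm_num
  · right; refine ⟨?_, hD⟩; rw [hn]; simp
  · left; rw [hn]; simp; field_simp; norm_num
  · exfalso
    refine not_scalar hψ ga_ne N.ha (c := -μ) ?_
    convert hD using 2 with i
    fin_cases i <;> simp

theorem local_B {k : Type} [Field k] [IsAlgClosed k] (h3 : (3 : k) ≠ 0)
    {ψ : A5 →* PGLmk 4 k} (hψ : IsRegularHom ψ) {A B : GLmk 4 k} {l : k} (N : NormLift ψ A B l)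
    {ω : k} (hω : IsPrimitiveRoot ω 3) :
    nchar ψ gb = 4 ∨ (nchar ψ gb = 1 ∧
      DiagBy B.val (fun i => ω ^ ((![0, 0, 1, 2] : Fin 4 → Fin 3) i).val)) := by
  obtain ⟨e, he⟩ := diag_exp 3 (by exact_mod_cast h3) hω B.val 1 one_ne_zero
    (by rw [← Units.val_pow_eq_pow_val, N.hB]; simp)
  simp only [one_mul] at he
  obtain ⟨y, hy⟩ := gb_conj_inv
  have hdual := self_dual_exp 3 hω B e he
    (charpoly_inv_eq ψ gb y hy B N.hb 3 N.hB N.dB (by norm_num))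
  obtain ⟨f, hf, hfe⟩ := exps_three e hdual
  have hD : DiagBy B.val (fun i => ω ^ (f i).val) := he.of_map_eq (F := fun j => ω ^ j.val) hfe
  have hI : DiagBy B⁻¹.val (fun i => (ω ^ (f i).val) ^ 2) := hD.inv (fun i => by
    rw [← pow_succ', ← pow_mul, mul_comm, pow_mul, hω.pow_eq_one, one_pow])
  have hn := nchar_eq ψ gb B N.hb
  rw [hD.trace, hI.trace] at hn
  have hz := prim3 hω
  simp only [List.mem_cons, List.not_mem_nil, or_false] at hf
  rcases hf with rfl | rfl | rfl
  · exfalso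
    refine not_scalar hψ gb_ne N.hb (c := 1) ?_
    convert hD using 2 with i
    fin_cases i <;> simp
  · right; refine ⟨?_, hD⟩; rw [hn]; simp; grind
  · left; rw [hn]; simp; grind

theorem local_C {k : Type} [Field k] [IsAlgClosed k] (h5 : (5 : k) ≠ 0)
    {ψ : A5 →* PGLmk 4 k} (hψ : IsRegularHom ψ) {A B : GLmk 4 k} {l : k} (N : NormLift ψ A B l)
    {ζ : k} (hζ : IsPrimitiveRoot ζ 5) :
    nchar ψ (ga * gb) + nchar ψ ((ga * gb) ^ 2) = 7 ∨
    nchar ψ (ga * gb) + nchar ψ ((ga * gb) ^ 2) = 12 ∨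
    (nchar ψ (ga * gb) + nchar ψ ((ga * gb) ^ 2) = 2 ∧
      DiagBy (A * B).val (fun i => ζ ^ ((![1, 2, 3, 4] : Fin 4 → Fin 5) i).val)) := by
  have hC5 := N.hC
  obtain ⟨C, hCdef⟩ : ∃ C, C = A * B := ⟨_, rfl⟩
  rw [← hCdef] at hC5 ⊢
  have hc : pglQuot 4 k C = ψ (ga * gb) := by rw [hCdef, map_mul, map_mul, N.ha, N.hb]
  have dC : C.val.det = 1 := by rw [hCdef, Units.val_mul, Matrix.det_mul, N.dA, N.dB, one_mul]
  obtain ⟨e, he⟩ := diag_exp 5 (by exact_mod_cast h5) hζ C.val 1 one_ne_zero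
    (by rw [← Units.val_pow_eq_pow_val, hC5]; simp)
  simp only [one_mul] at he
  obtain ⟨y, hy⟩ := gab_conj_inv
  have hdual := self_dual_exp 5 hζ C e he
    (charpoly_inv_eq ψ (ga * gb) y hy C hc 5 hC5 dC (by norm_num))
  obtain ⟨f, hf, hfe⟩ := exps_five e hdual
  have hD : DiagBy C.val (fun i => ζ ^ (f i).val) := he.of_map_eq (F := fun j => ζ ^ j.val) hfe
  have hI : DiagBy C⁻¹.val (fun i => (ζ ^ (f i).val) ^ 4) := hD.inv (fun i => by
    rw [← pow_succ', ← pow_mul, mul_comm, pow_mul, hζ.pow_eq_one, one_pow])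
  have hn := nchar_eq ψ (ga * gb) C hc
  rw [hD.trace, hI.trace] at hn
  have hn2 := nchar_eq ψ ((ga * gb) ^ 2) (C * C) (by rw [map_mul, hc, ← map_mul, sq])
  rw [mul_inv_rev, Units.val_mul, Units.val_mul, hD.mul_self.trace, hI.mul_self.trace] at hn2
  have hz := prim5 hζ
  simp only [List.mem_cons, List.not_mem_nil, or_false] at hf
  rcases hf with rfl | rfl | rfl | rfl | rfl | rfl
  · exfalso
    refine not_scalar hψ gab_ne hc (c := 1) ?_
    convert hD using 2 with i
    fin_cases i <;> simp
  · left; rw [hn, hn2]; simp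
    linear_combination ((1) * ζ ^ 0 + (1) * ζ ^ 1 + (-2) * ζ ^ 3 + (4) * ζ ^ 4 + (-2) * ζ ^ 5 + (3) * ζ ^ 8 + (-1) * ζ ^ 9 + (-1) * ζ ^ 10 + (-1) * ζ ^ 11 + (3) * ζ ^ 13 + (-1) * ζ ^ 14 + (-1) * ζ ^ 15 + (2) * ζ ^ 16 + (-2) * ζ ^ 17 + (2) * ζ ^ 18 + (-1) * ζ ^ 19 + (1) * ζ ^ 21 + (-2) * ζ ^ 22 + (2) * ζ ^ 23 + (-1) * ζ ^ 24 + (1) * ζ ^ 26 + (-2) * ζ ^ 27 + (2) * ζ ^ 28 + (-1) * ζ ^ 29 + (1) * ζ ^ 31 + (-1) * ζ ^ 35 + (1) * ζ ^ 36) * hz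
  · left; rw [hn, hn2]; simp
    linear_combination ((1) * ζ ^ 0 + (-1) * ζ ^ 1 + (2) * ζ ^ 2 + (-1) * ζ ^ 5 + (1) * ζ ^ 6 + (2) * ζ ^ 8 + (-2) * ζ ^ 9 + (1) * ζ ^ 11 + (1) * ζ ^ 12 + (-1) * ζ ^ 14 + (2) * ζ ^ 16 + (-1) * ζ ^ 17 + (-1) * ζ ^ 19 + (1) * ζ ^ 20 + (1) * ζ ^ 21 + (-1) * ζ ^ 23 + (1) * ζ ^ 24 + (-1) * ζ ^ 25 + (1) * ζ ^ 26) * hz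
  · right; left; rw [hn, hn2]; simp
    linear_combination ((-12) * ζ ^ 0 + (12) * ζ ^ 1 + (-8) * ζ ^ 5 + (8) * ζ ^ 6 + (4) * ζ ^ 8 + (-4) * ζ ^ 9 + (-4) * ζ ^ 10 + (4) * ζ ^ 11 + (4) * ζ ^ 13 + (-4) * ζ ^ 14 + (-4) * ζ ^ 15 + (8) * ζ ^ 16 + (-4) * ζ ^ 19 + (4) * ζ ^ 21 + (-4) * ζ ^ 24 + (4) * ζ ^ 26 + (-4) * ζ ^ 29 + (4) * ζ ^ 31 + (-4) * ζ ^ 35 + (4) * ζ ^ 36) * hz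
  · right; left; rw [hn, hn2]; simp
    linear_combination ((-12) * ζ ^ 0 + (12) * ζ ^ 1 + (-12) * ζ ^ 5 + (12) * ζ ^ 6 + (-8) * ζ ^ 10 + (12) * ζ ^ 11 + (-4) * ζ ^ 12 + (4) * ζ ^ 14 + (-8) * ζ ^ 15 + (8) * ζ ^ 16 + (-4) * ζ ^ 17 + (4) * ζ ^ 19 + (-4) * ζ ^ 20 + (4) * ζ ^ 21 + (-4) * ζ ^ 23 + (4) * ζ ^ 24 + (-4) * ζ ^ 25 + (4) * ζ ^ 26) * hz
  · right; right; refine ⟨?_, hD⟩; rw [hn, hn2]; simp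
    linear_combination ((-2) * ζ ^ 0 + (2) * ζ ^ 1 + (-1) * ζ ^ 5 + (2) * ζ ^ 6 + (1) * ζ ^ 11 + (1) * ζ ^ 12 + (-1) * ζ ^ 13 + (1) * ζ ^ 14 + (-1) * ζ ^ 15 + (2) * ζ ^ 16 + (1) * ζ ^ 22 + (-1) * ζ ^ 23 + (1) * ζ ^ 24 + (-1) * ζ ^ 25 + (1) * ζ ^ 26 + (1) * ζ ^ 32 + (-1) * ζ ^ 33 + (1) * ζ ^ 34 + (-1) * ζ ^ 35 + (1) * ζ ^ 36) * hz

theorem local_data {k : Type} [Field k] [IsAlgClosed k] (h2 : (2 : k) ≠ 0) (h3 : (3 : k) ≠ 0)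
    (h5 : (5 : k) ≠ 0)
    {ψ : A5 →* PGLmk 4 k} (hψ : IsRegularHom ψ) {A B : GLmk 4 k} {l : k} (N : NormLift ψ A B l)
    {μ ω ζ : k} (hμ : μ ^ 2 = l) (hω : IsPrimitiveRoot ω 3) (hζ : IsPrimitiveRoot ζ 5) :
    DiagBy A.val (fun i => μ * (-1) ^ ((![0, 0, 1, 1] : Fin 4 → Fin 2) i).val) ∧
    DiagBy B.val (fun i => ω ^ ((![0, 0, 1, 2] : Fin 4 → Fin 3) i).val) ∧
    DiagBy (A * B).val (fun i => ζ ^ ((![1, 2, 3, 4] : Fin 4 → Fin 5) i).val) := by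
  have h4 : (4 : k) ≠ 0 := by
    have : (4 : k) = 2 * 2 := by norm_num
    rw [this]; exact mul_ne_zero h2 h2
  have h60 : (60 : k) ≠ 0 := by
    have : (60 : k) = 4 * 3 * 5 := by norm_num
    rw [this]; exact mul_ne_zero (mul_ne_zero h4 h3) h5
  have hsum := sum_nchar h4 hψ
  rw [class_sum _ (nchar_conj ψ)] at hsum
  have h1 : nchar ψ 1 = 16 := by
    rw [nchar_eq ψ 1 1 (by simp)]; simp; norm_num
  rw [h1] at hsum
  have hb := local_B h3 hψ N hω
  have hc := local_C h5 hψ N hζ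
  have key1 : ∀ m : k, m ≠ 0 → (60 : k) * m ≠ 0 := fun m hm => mul_ne_zero h60 hm
  have one := one_ne_zero (α := k)
  rcases local_A h2 hψ N hμ with ha | ⟨ha, hA⟩
  · exfalso
    rcases hb with hb | ⟨hb, -⟩ <;> rcases hc with hc | hc | ⟨hc, -⟩ <;> rw [ha, hb] at hsum
    · exact key1 _ h3 (by linear_combination hsum - 12 * hc)
    · exact key1 _ h4 (by linear_combination hsum - 12 * hc)
    · exact key1 _ h2 (by linear_combination hsum - 12 * hc)
    · exact key1 _ h2 (by linear_combination hsum - 12 * hc)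
    · exact key1 _ h3 (by linear_combination hsum - 12 * hc)
    · exact key1 _ one (by linear_combination hsum - 12 * hc)
  · rcases hb with hb | ⟨hb, hB⟩ <;> rcases hc with hc | hc | ⟨hc, hC⟩ <;> rw [ha, hb] at hsum
    · exact absurd (by linear_combination hsum - 12 * hc) (key1 _ h2)
    · exact absurd (by linear_combination hsum - 12 * hc) (key1 _ h3)
    · exact absurd (by linear_combination hsum - 12 * hc) (key1 _ one)
    · exact absurd (by linear_combination hsum - 12 * hc) (key1 _ one)
    · exact absurd (by linear_combination hsum - 12 * hc) (key1 _ h2)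
    · exact ⟨hA, hB, hC⟩

theorem normLift_sq {k : Type} [Field k] [IsAlgClosed k] (h2 : (2 : k) ≠ 0) (h3 : (3 : k) ≠ 0)
    (h5 : (5 : k) ≠ 0)
    {ψ : A5 →* PGLmk 4 k} (hψ : IsRegularHom ψ) {A B : GLmk 4 k} {l : k} (N : NormLift ψ A B l)
    {μ ω ζ : k} (hμ : μ ^ 2 = l) (hω : IsPrimitiveRoot ω 3) (hζ : IsPrimitiveRoot ζ 5) :
    l = 1 ∨ l = -1 := by
  have h := (local_data h2 h3 h5 hψ N hμ hω hζ).1.det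
  rw [N.dA] at h
  simp at h
  apply mul_self_eq_one_iff.mp
  rw [← hμ]
  linear_combination -h

/-! ### Rigidity -/

theorem scott {k V : Type} [Field k] [AddCommGroup V] [Module k V] [FiniteDimensional k V]
    (α β : V →ₗ[k] V) (a b c : ℕ)
    (ha : Module.finrank k (LinearMap.range (LinearMap.id - α)) ≤ a)
    (hb : Module.finrank k (LinearMap.range (LinearMap.id - β)) ≤ b)
    (hc : Module.finrank k (LinearMap.range (LinearMap.id - α ∘ₗ β)) ≤ c)
    (habc : a + b + c < 2 * Module.finrank k V) :
    (∃ v, v ≠ 0 ∧ α v = v ∧ β v = v) ∨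
      LinearMap.range (LinearMap.id - α) ⊔ LinearMap.range (LinearMap.id - β) ≠ ⊤ := by
  by_contra! hcon
  obtain ⟨h1, h2⟩ := hcon
  set R1 := LinearMap.range (LinearMap.id - α) with hR1
  set R2 := LinearMap.range (LinearMap.id - β) with hR2
  let S : R1 × R2 →ₗ[k] V := LinearMap.coprod R1.subtype R2.subtype
  let D : V →ₗ[k] R1 × R2 :=
    LinearMap.prod ((LinearMap.id - α).rangeRestrict ∘ₗ β) (LinearMap.id - β).rangeRestrict
  have hSD : S ∘ₗ D = LinearMap.id - α ∘ₗ β := by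
    ext v
    simp [S, D]
  have hS : LinearMap.range S = ⊤ := by
    simp only [S, LinearMap.range_coprod, Submodule.range_subtype]
    exact h2
  have hD : Function.Injective D := by
    rw [← LinearMap.ker_eq_bot, LinearMap.ker_eq_bot']
    intro v hv
    by_contra h0
    have e1 : β v - α (β v) = 0 := congrArg (fun x => (x.1 : V)) hv
    have e2 : v - β v = 0 := congrArg (fun x => (x.2 : V)) hv
    have e3 : β v = v := (sub_eq_zero.mp e2).symm
    rw [e3] at e1
    exact h1 v h0 (sub_eq_zero.mp e1).symm e3
  have r1 := LinearMap.finrank_range_add_finrank_ker S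
  have r2 := LinearMap.finrank_range_add_finrank_ker (LinearMap.id - α ∘ₗ β)
  rw [hS, finrank_top, Module.finrank_prod] at r1
  have hle : Module.finrank k (LinearMap.ker (LinearMap.id - α ∘ₗ β)) ≤
      Module.finrank k (LinearMap.ker S) := by
    refine LinearMap.finrank_le_finrank_of_injective
      (f := D.restrict (p := LinearMap.ker (LinearMap.id - α ∘ₗ β)) (q := LinearMap.ker S) ?_) ?_
    · intro x hx
      rw [← hSD] at hx
      exact hx
    · intro x y hxy
      exact Subtype.ext (hD (congrArg Subtype.val hxy))
  omega

/-- The linear map `T ↦ M T N`. -/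
noncomputable def twist {k : Type} [Field k] (M N : Matrix (Fin 4) (Fin 4) k) :
    Matrix (Fin 4) (Fin 4) k →ₗ[k] Matrix (Fin 4) (Fin 4) k :=
  LinearMap.mulLeft k M ∘ₗ LinearMap.mulRight k N

theorem twist_apply {k : Type} [Field k] (M N T : Matrix (Fin 4) (Fin 4) k) :
    twist M N T = M * (T * N) := rfl

theorem rank_twist {k : Type} [Field k] {n : ℕ} (M N : GLmk 4 k) (F : Fin n → k) (f : Fin 4 → Fin n)
    (hM : DiagBy M.val (fun i => F (f i))) (hN : DiagBy N.val (fun i => F (f i))) :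
    Module.finrank k (LinearMap.range (LinearMap.id - twist M.val N⁻¹.val)) ≤
      Fintype.card {p : Fin 4 × Fin 4 // f p.1 ≠ f p.2} := by
  obtain ⟨P, hP⟩ := hM
  obtain ⟨Q, hQ⟩ := hN
  have hP1 : P⁻¹.val * M.val = Matrix.diagonal (fun i => F (f i)) * P⁻¹.val := by
    have e1 : P⁻¹.val * P.val = 1 := by rw [← Units.val_mul, inv_mul_cancel, Units.val_one]
    have e2 : P.val * P⁻¹.val = 1 := by rw [← Units.val_mul, mul_inv_cancel, Units.val_one]
    calc P⁻¹.val * M.val = P⁻¹.val * (M.val * P.val) * P⁻¹.val := by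
          rw [mul_assoc, mul_assoc, e2, mul_one]
      _ = _ := by rw [hP, ← mul_assoc, e1, one_mul]
  let E : Matrix (Fin 4) (Fin 4) k →ₗ[k] ({p : Fin 4 × Fin 4 // f p.1 ≠ f p.2} → k) :=
    { toFun := fun X p => (twist P⁻¹.val Q.val X) p.1.1 p.1.2
      map_add' := fun X Y => by ext p; simp
      map_smul' := fun c X => by ext p; simp }
  rw [← Module.finrank_fintype_fun_eq_card (R := k)]
  refine LinearMap.finrank_le_finrank_of_injective
    (f := E ∘ₗ (LinearMap.range (LinearMap.id - twist M.val N⁻¹.val)).subtype) ?_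
  rw [← LinearMap.ker_eq_bot, LinearMap.ker_eq_bot']
  rintro ⟨X, T, rfl⟩ hX
  have hz : twist P⁻¹.val Q.val (T - twist M.val N⁻¹.val T) = 0 := by
    ext i j
    by_cases hij : f i = f j
    · have e1 : twist P⁻¹.val Q.val (T - twist M.val N⁻¹.val T) =
          (P⁻¹.val * (T * N⁻¹.val) * Q.val) * Matrix.diagonal (fun i => F (f i)) -
          Matrix.diagonal (fun i => F (f i)) * (P⁻¹.val * (T * N⁻¹.val) * Q.val) := by
        have e2 : N⁻¹.val * N.val = 1 := by rw [← Units.val_mul, inv_mul_cancel, Units.val_one]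
        rw [mul_assoc _ Q.val, ← hQ, ← mul_assoc (Matrix.diagonal _), ← mul_assoc (Matrix.diagonal _),
          ← hP1]
        simp only [twist_apply]
        rw [sub_mul, mul_sub]
        congr 1
        · simp only [mul_assoc]
          rw [← mul_assoc _ N.val, e2, one_mul]
        · simp only [mul_assoc]
      rw [e1, Matrix.sub_apply, Matrix.mul_diagonal, Matrix.diagonal_mul, hij, mul_comm, sub_self]
      rfl
    · exact congrFun hX ⟨(i, j), hij⟩
  rw [twist_apply] at hz
  apply Subtype.ext
  have e1 : P.val * P⁻¹.val = 1 := by rw [← Units.val_mul, mul_inv_cancel, Units.val_one]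
  have e2 : Q.val * Q⁻¹.val = 1 := by rw [← Units.val_mul, mul_inv_cancel, Units.val_one]
  have h3 := congrArg (fun Z => P.val * (Z * Q⁻¹.val)) hz
  simp only [zero_mul, mul_zero, mul_assoc, e2, mul_one] at h3
  rw [← mul_assoc, e1, one_mul] at h3
  exact h3

theorem dual_eq_trace {k : Type} [Field k] (φ : Matrix (Fin 4) (Fin 4) k →ₗ[k] k) :
    ∃ S : Matrix (Fin 4) (Fin 4) k, ∀ T, φ T = (S * T).trace := by
  refine ⟨Matrix.of fun j i => φ (Matrix.single i j 1), fun T => ?_⟩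
  have : T = ∑ i, ∑ j, T i j • Matrix.single i j 1 := by
    conv_lhs => rw [Matrix.matrix_eq_sum_single T]
    simp [Matrix.smul_single]
  conv_lhs => rw [this]
  simp only [map_sum, map_smul, Matrix.trace, Matrix.diag, Matrix.mul_apply, Matrix.of_apply,
    smul_eq_mul]
  rw [Finset.sum_comm]
  simp only [mul_comm]

theorem regular_gens {k : Type} [Field k] {ψ : A5 →* PGLmk 4 k} (hψ : IsRegularHom ψ)
    {A B : GLmk 4 k} (ha : pglQuot 4 k A = ψ ga) (hb : pglQuot 4 k B = ψ gb)
    (W : Submodule k (Fin 4 → k)) (hA : ∀ v ∈ W, A.val.mulVec v ∈ W)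
    (hB : ∀ v ∈ W, B.val.mulVec v ∈ W) : W = ⊥ ∨ W = ⊤ := by
  have key : ∀ g h : GLmk 4 k, pglQuot 4 k g = pglQuot 4 k h →
      (∀ v ∈ W, h.val.mulVec v ∈ W) → ∀ v ∈ W, g.val.mulVec v ∈ W := by
    intro g h hgh hh v hv
    obtain ⟨s, -, hs⟩ := (pgl_eq_iff g h).mp hgh
    rw [hs, Matrix.smul_mulVec]
    exact W.smul_mem _ (hh v hv)
  have main : ∀ x : A5, ∀ g : GLmk 4 k, pglQuot 4 k g = ψ x → ∀ v ∈ W, g.val.mulVec v ∈ W := by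
    intro x
    have hx : x ∈ Submonoid.closure ({ga, gb} : Set A5) := by
      rw [← Subgroup.closure_toSubmonoid_of_finite, closure_gen]; trivial
    induction hx using Submonoid.closure_induction with
    | mem x hx =>
      intro g hg
      rcases hx with rfl | rfl
      · exact key g A (hg.trans ha.symm) hA
      · exact key g B (hg.trans hb.symm) hB
    | one =>
      intro g hg
      refine key g 1 (by rw [hg, map_one, map_one]) ?_
      intro v hv
      rwa [Units.val_one, Matrix.one_mulVec]
    | mul x y _ _ hx hy =>
      intro g hg
      refine key g (lift ψ x * lift ψ y) (by rw [hg, map_mul, map_mul, lift_spec, lift_spec]) ?_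
      intro v hv
      rw [Units.val_mul, ← Matrix.mulVec_mulVec]
      exact hx _ (lift_spec ψ x) _ (hy _ (lift_spec ψ y) _ hv)
  apply hψ
  rintro g ⟨x, hx⟩
  exact main x g hx.symm

theorem PGLConj.symm {k : Type} [Field k] {ψ φ : A5 →* PGLmk 4 k} (h : PGLConj ψ φ) :
    PGLConj φ ψ := by
  obtain ⟨y, hy⟩ := h
  refine ⟨y⁻¹, fun x => ?_⟩
  rw [hy]; group

theorem intertwine {k : Type} [Field k] {ψ φ : A5 →* PGLmk 4 k} (hφ : IsRegularHom φ)
    {A B A' B' : GLmk 4 k} (ha : pglQuot 4 k A = ψ ga) (hb : pglQuot 4 k B = ψ gb)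
    (ha' : pglQuot 4 k A' = φ ga) (hb' : pglQuot 4 k B' = φ gb)
    (T : Matrix (Fin 4) (Fin 4) k) (hT : T ≠ 0) (hA : A.val * T = T * A'.val)
    (hB : B.val * T = T * B'.val) : PGLConj φ ψ := by
  have hinv : ∀ {X X' : GLmk 4 k}, X.val * T = T * X'.val → ∀ v ∈ LinearMap.ker (Matrix.toLin' T),
      X'.val.mulVec v ∈ LinearMap.ker (Matrix.toLin' T) := by
    intro X X' h v hv
    rw [LinearMap.mem_ker, Matrix.toLin'_apply] at hv ⊢
    rw [Matrix.mulVec_mulVec, ← h, ← Matrix.mulVec_mulVec, hv, Matrix.mulVec_zero]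
  rcases regular_gens hφ ha' hb' _ (hinv hA) (hinv hB) with h | h
  · have hu : IsUnit T := by
      rw [← Matrix.mulVec_injective_iff_isUnit]
      exact LinearMap.ker_eq_bot.mp h
    obtain ⟨U, rfl⟩ := hu
    have hA2 : A = U * A' * U⁻¹ := by
      rw [eq_mul_inv_iff_mul_eq]; exact Units.ext hA
    have hB2 : B = U * B' * U⁻¹ := by
      rw [eq_mul_inv_iff_mul_eq]; exact Units.ext hB
    have e : ψ = (MulAut.conj (pglQuot 4 k U)).toMonoidHom.comp φ := by
      apply hom_ext_gen
      · rw [← ha, hA2]; simp [ha']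
      · rw [← hb, hB2]; simp [hb']
    refine ⟨pglQuot 4 k U, fun x => ?_⟩
    rw [e]; rfl
  · exfalso
    apply hT
    rw [LinearMap.ker_eq_top] at h
    exact (LinearEquiv.map_eq_zero_iff _).mp h

theorem rigidity {k : Type} [Field k] [IsAlgClosed k] (h2 : (2 : k) ≠ 0) (h3 : (3 : k) ≠ 0)
    (h5 : (5 : k) ≠ 0) {ψ φ : A5 →* PGLmk 4 k} (hψ : IsRegularHom ψ) (hφ : IsRegularHom φ)
    {A B A' B' : GLmk 4 k} {l : k} (N : NormLift ψ A B l) (N' : NormLift φ A' B' l)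
    {μ ω ζ : k} (hμ : μ ^ 2 = l) (hω : IsPrimitiveRoot ω 3) (hζ : IsPrimitiveRoot ζ 5) :
    PGLConj φ ψ := by
  obtain ⟨dA, dB, dC⟩ := local_data h2 h3 h5 hψ N hμ hω hζ
  obtain ⟨dA', dB', dC'⟩ := local_data h2 h3 h5 hφ N' hμ hω hζ
  have rA := rank_twist A A' (fun j => μ * (-1) ^ j.val) _ dA dA'
  have rB := rank_twist B B' (fun j => ω ^ j.val) _ dB dB'
  have rC := rank_twist (A * B) (A' * B') (fun j => ζ ^ j.val) _ dC dC'
  have cA : Fintype.card {p : Fin 4 × Fin 4 // (![0, 0, 1, 1] : Fin 4 → Fin 2) p.1 ≠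
    (![0, 0, 1, 1] : Fin 4 → Fin 2) p.2} = 8 := by decide
  have cB : Fintype.card {p : Fin 4 × Fin 4 // (![0, 0, 1, 2] : Fin 4 → Fin 3) p.1 ≠
    (![0, 0, 1, 2] : Fin 4 → Fin 3) p.2} = 10 := by decide
  have cC : Fintype.card {p : Fin 4 × Fin 4 // (![1, 2, 3, 4] : Fin 4 → Fin 5) p.1 ≠
    (![1, 2, 3, 4] : Fin 4 → Fin 5) p.2} = 12 := by decide
  rw [cA] at rA
  rw [cB] at rB
  rw [cC] at rC
  have hcomp : twist (A * B).val (A' * B')⁻¹.val =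
      twist A.val A'⁻¹.val ∘ₗ twist B.val B'⁻¹.val := by
    ext1 T
    simp only [LinearMap.comp_apply, twist_apply, mul_inv_rev, Units.val_mul, mul_assoc]
  rw [hcomp] at rC
  have uA : A'⁻¹.val * A'.val = 1 := by rw [← Units.val_mul, inv_mul_cancel, Units.val_one]
  have uB : B'⁻¹.val * B'.val = 1 := by rw [← Units.val_mul, inv_mul_cancel, Units.val_one]
  have vA : A'.val * A'⁻¹.val = 1 := by rw [← Units.val_mul, mul_inv_cancel, Units.val_one]
  have vB : B'.val * B'⁻¹.val = 1 := by rw [← Units.val_mul, mul_inv_cancel, Units.val_one]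
  rcases scott _ _ 8 10 12 rA rB rC (by rw [Module.finrank_matrix]; simp) with
    ⟨T, hT, eA, eB⟩ | hne
  · refine intertwine hφ N.ha N.hb N'.ha N'.hb T hT ?_ ?_
    · conv_rhs => rw [← eA]
      rw [twist_apply, mul_assoc, mul_assoc, uA, mul_one]
    · conv_rhs => rw [← eB]
      rw [twist_apply, mul_assoc, mul_assoc, uB, mul_one]
  · obtain ⟨f, hf0, hf⟩ := Submodule.exists_le_ker_of_lt_top _ (lt_top_iff_ne_top.mpr hne)
    obtain ⟨S, hS⟩ := dual_eq_trace f
    have hS0 : S ≠ 0 := by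
      rintro rfl
      apply hf0
      ext1 T
      rw [hS]; simp
    have key : ∀ X X' : GLmk 4 k,
        LinearMap.range (LinearMap.id - twist X.val X'⁻¹.val) ≤ LinearMap.ker f →
        X'.val * S = S * X.val := by
      intro X X' h
      have e : S = X'⁻¹.val * S * X.val := by
        rw [Matrix.ext_iff_trace_mul_right]
        intro T
        have h1 : f (T - twist X.val X'⁻¹.val T) = 0 := h ⟨T, rfl⟩
        rw [map_sub, twist_apply, hS, hS, sub_eq_zero] at h1
        rw [h1, ← mul_assoc, ← mul_assoc, Matrix.trace_mul_comm]
        simp only [mul_assoc]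
      have v : X'.val * X'⁻¹.val = 1 := by rw [← Units.val_mul, mul_inv_cancel, Units.val_one]
      conv_lhs => rw [e]
      rw [← mul_assoc, ← mul_assoc, v, one_mul]
    exact (intertwine hψ N'.ha N'.hb N.ha N.hb S hS0 (key _ _ (le_sup_left.trans hf))
      (key _ _ (le_sup_right.trans hf))).symm

/-! ### The standard representation -/

/-- The standard four-dimensional integral representation of `A₅`. -/
def stdZ (x : A5) : Matrix (Fin 4) (Fin 4) ℤ := Matrix.of fun i j =>
  (if i.castSucc = x.val j.castSucc then 1 else 0) - (if 4 = x.val j.castSucc then 1 else 0)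

theorem stdZ_mul (x y : A5) : stdZ (x * y) = stdZ x * stdZ y := by
  ext i j
  have hs : ∀ a : Fin 5, ∑ m, (if a = x.val m then (1 : ℤ) else 0) = 1 := by
    intro a
    rw [Equiv.sum_comp x.val (fun m => if a = m then (1 : ℤ) else 0)]
    simp
  have h1 := hs i.castSucc
  have h2 := hs 4
  have key : ∀ c : Fin 5, ((if i.castSucc = x.val c then (1 : ℤ) else 0) -
      (if 4 = x.val c then 1 else 0)) = ∑ m : Fin 4, ((if i.castSucc = x.val m.castSucc then 1 else 0)
        - (if 4 = x.val m.castSucc then 1 else 0)) *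
        ((if m.castSucc = c then 1 else 0) - (if 4 = c then 1 else 0)) := by
    intro c
    rw [Fin.sum_univ_five] at h1 h2
    rw [Fin.sum_univ_four]
    fin_cases c <;> simp <;> linarith
  rw [Matrix.mul_apply]
  exact key (y.val j.castSucc)

theorem stdZ_one : stdZ 1 = 1 := by decide

/-- The standard representation of `A₅` in `GL₄(k)`. -/
noncomputable def stdRep (k : Type) [Field k] : A5 →* GLmk 4 k :=
  MonoidHom.toHomUnits
    ((Int.castRingHom k).mapMatrix.toMonoidHom.comp
      { toFun := stdZ, map_one' := stdZ_one, map_mul' := stdZ_mul })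

theorem stdRep_val (k : Type) [Field k] (x : A5) :
    (stdRep k x).val = (stdZ x).map (Int.castRingHom k) := rfl

set_option maxRecDepth 100000 in
theorem stdZ_sum : ∑ x ∈ Finset.univ.filter (fun x : A5 => x.val 4 = 4), stdZ x =
    Matrix.of fun _ _ => 3 := by decide +kernel

set_option maxRecDepth 100000 in
theorem stdZ_row : ∀ j : Fin 4, ∃ x : A5, ∀ i, ∑ m, stdZ x m i = 1 - if i = j then 5 else 0 := by
  decide +kernel

set_option maxRecDepth 100000 in
theorem stdZ_col : ∀ j : Fin 4, ∃ x : A5, ∀ i, ∑ m, stdZ x i m = if i = j then -1 else 0 := by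
  decide +kernel

theorem std_regular (k : Type) [Field k] (h3 : (3 : k) ≠ 0) (h5 : (5 : k) ≠ 0) :
    IsRegularHom ((pglQuot 4 k).comp (stdRep k)) := by
  intro W hW
  have hinv : ∀ x : A5, ∀ v ∈ W, ((stdZ x).map (Int.castRingHom k)).mulVec v ∈ W :=
    fun x v hv => hW (stdRep k x) ⟨x, rfl⟩ v hv
  rw [or_iff_not_imp_left]
  intro hne
  obtain ⟨w, hw, hw0⟩ := Submodule.exists_mem_ne_zero_of_ne_bot hne
  have h1 : ∃ v ∈ W, ∑ i, v i ≠ 0 := by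
    by_contra! hcon
    apply hw0
    funext j
    obtain ⟨x, hx⟩ := stdZ_row j
    have e1 := hcon _ (hinv x w hw)
    have e2 := hcon w hw
    have e3 : ∑ i, (((stdZ x).map (Int.castRingHom k)).mulVec w) i = ∑ i, w i - 5 * w j := by
      simp only [Matrix.mulVec, dotProduct]
      rw [Finset.sum_comm]
      have : ∀ i, ∑ m, (stdZ x).map (Int.castRingHom k) m i * w i =
          w i - if i = j then 5 * w i else 0 := by
        intro i
        rw [← Finset.sum_mul]
        have h := congrArg (Int.castRingHom k) (hx i)
        rw [map_sum] at h
        simp only [Matrix.map_apply]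
        rw [h]
        split_ifs <;> simp <;> ring
      simp only [this, Finset.sum_sub_distrib, Finset.sum_ite_eq', Finset.mem_univ, if_true]
    rw [e1, e2, zero_sub, eq_comm, neg_eq_zero] at e3
    exact (mul_eq_zero.mp e3).resolve_left h5
  obtain ⟨v, hv, hv0⟩ := h1
  have h2 : (fun _ => 1 : Fin 4 → k) ∈ W := by
    have e1 : (∑ x ∈ Finset.univ.filter (fun x : A5 => x.val 4 = 4),
        ((stdZ x).map (Int.castRingHom k)).mulVec v) ∈ W :=
      W.sum_mem fun x _ => hinv x v hv
    have e2 : (∑ x ∈ Finset.univ.filter (fun x : A5 => x.val 4 = 4),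
        ((stdZ x).map (Int.castRingHom k)).mulVec v) = (3 * ∑ i, v i) • (fun _ => 1 : Fin 4 → k) := by
      rw [← Matrix.sum_mulVec]
      have e3 := congrArg (Int.castRingHom k).mapMatrix stdZ_sum
      rw [map_sum] at e3
      simp only [RingHom.mapMatrix_apply] at e3
      rw [e3]
      funext i
      simp [Matrix.mulVec, dotProduct, Finset.mul_sum]
    rw [e2] at e1
    exact (W.smul_mem_iff (mul_ne_zero h3 hv0)).mp e1
  have h4 : ∀ j, (Pi.single j 1 : Fin 4 → k) ∈ W := by
    intro j
    obtain ⟨x, hx⟩ := stdZ_col j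
    have e1 := hinv x _ h2
    have e2 : ((stdZ x).map (Int.castRingHom k)).mulVec (fun _ => 1) = - Pi.single j (1 : k) := by
      funext i
      have h := congrArg (Int.castRingHom k) (hx i)
      rw [map_sum] at h
      simp only [Matrix.mulVec, dotProduct, Matrix.map_apply, mul_one]
      rw [h]
      by_cases hij : i = j
      · subst hij; simp
      · simp [hij]
    rw [e2] at e1
    exact W.neg_mem_iff.mp e1
  rw [eq_top_iff]
  intro u _
  have : u = ∑ j, u j • (Pi.single j 1 : Fin 4 → k) := by
    rw [pi_eq_sum_univ' u]
    funext i
    simp [Finset.sum_apply, Pi.single_apply, eq_comm]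
  rw [this]
  exact W.sum_mem fun j _ => W.smul_mem _ (h4 j)

/-- The invariant `l` can be computed from any lifts satisfying the relations. -/
theorem sign_eq {k : Type} [Field k] {ψ : A5 →* PGLmk 4 k}
    {A B : GLmk 4 k} {l : k} (N : NormLift ψ A B l) (hl : l ^ 2 = 1) {A' B' : GLmk 4 k}
    (ha : pglQuot 4 k A' = ψ ga) (hb : pglQuot 4 k B' = ψ gb) {c : k} (hc : c ^ 2 = 1)
    (hA : A'.val ^ 2 = c • 1) (hB : B' ^ 3 = 1) (hC : (A' * B') ^ 5 = 1) : l = c := by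
  obtain ⟨s, -, hs⟩ := (pgl_eq_iff _ _).mp (ha.trans N.ha.symm)
  obtain ⟨t, -, ht⟩ := (pgl_eq_iff _ _).mp (hb.trans N.hb.symm)
  have scal : ∀ a b : k, a • (1 : Matrix (Fin 4) (Fin 4) k) = b • 1 → a = b := by
    intro a b h
    simpa using congrFun (congrFun h 0) 0
  have e1 : s ^ 2 * l = c := by
    apply scal
    rw [mul_smul, ← N.hA, ← smul_pow, ← hs, hA]
  have e2 : t ^ 3 = 1 := by
    apply scal
    have : (1 : Matrix (Fin 4) (Fin 4) k) = B.val ^ 3 := by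
      rw [← Units.val_pow_eq_pow_val, N.hB, Units.val_one]
    rw [this, ← smul_pow, ← ht, ← Units.val_pow_eq_pow_val, hB, Units.val_one, ← this, one_smul]
  have e3 : (s * t) ^ 5 = 1 := by
    apply scal
    have : (1 : Matrix (Fin 4) (Fin 4) k) = (A * B).val ^ 5 := by
      rw [← Units.val_pow_eq_pow_val, N.hC, Units.val_one]
    have e : (s * t) • (A * B).val = (A' * B').val := by
      rw [Units.val_mul, Units.val_mul, hs, ht, smul_mul_smul_comm]
    rw [this, ← smul_pow, e, ← Units.val_pow_eq_pow_val, hC, Units.val_one, ← this, one_smul]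
  have e5 : s ^ 30 = 1 := by
    calc s ^ 30 = ((s * t) ^ 5) ^ 6 * ((t ^ 3) ^ 10)⁻¹ := by
          rw [e2, mul_pow, mul_pow, ← pow_mul, ← pow_mul, show 5 * 6 = 3 * 10 by norm_num,
            pow_mul t, e2]
          simp
      _ = 1 := by rw [e2, e3]; simp
  calc l = (s ^ 30) * ((l ^ 2) ^ 7 * l) := by rw [e5, hl]; simp
    _ = (s ^ 2 * l) ^ 15 := by ring
    _ = (c ^ 2) ^ 7 * c := by rw [e1]; ring
    _ = c := by rw [hc]; simp

/-! ### The representation of the double cover -/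

/-- Pairs `(X, Y)` of integral matrices, standing for `X + ω Y`. -/
abbrev ZPair := Matrix (Fin 4) (Fin 4) ℤ × Matrix (Fin 4) (Fin 4) ℤ

/-- Multiplication of pairs modulo `ω² + ω + 1`. -/
def zmul (p q : ZPair) : ZPair :=
  (p.1 * q.1 - p.2 * q.2, p.1 * q.2 + p.2 * q.1 - p.2 * q.2)

/-- Evaluation of a pair. -/
def ev {k : Type} [Field k] (w : k) (p : ZPair) : Matrix (Fin 4) (Fin 4) k :=
  (Int.castRingHom k).mapMatrix p.1 + w • (Int.castRingHom k).mapMatrix p.2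

theorem ev_mul {k : Type} [Field k] {w : k} (hw : 1 + w + w ^ 2 = 0) (p q : ZPair) :
    ev w p * ev w q = ev w (zmul p q) := by
  simp only [ev, zmul, map_sub, map_add, map_mul]
  simp only [add_mul, mul_add, smul_mul_assoc, mul_smul_comm, smul_add]
  generalize (Int.castRingHom k).mapMatrix p.2 * (Int.castRingHom k).mapMatrix q.2 = X
  have hX : w • w • X = - X - w • X := by
    have : w • w • X = (1 + w + w ^ 2) • X - X - w • X := by module
    rw [this, hw, zero_smul, zero_sub]
  rw [hX]
  module

/-- The five projectors (times twelve) permuted by the group. -/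
def qZ : Fin 5 → ZPair := ![
  (!![6, -18, 6, 12; -1, 3, -1, -2; 1, -3, 9, -6; 1, -3, -3, 6],
    !![0, 0, 0, 0; 0, 0, 0, 0; 0, 0, 0, 0; 0, 0, 0, 0]),
  (!![6, 18, -6, 0; 0, 3, -1, 2; 0, -3, 9, 6; -1, 0, 0, 6],
    !![0, 18, -6, 12; -1, 0, 0, 2; 1, 0, 0, 6; -1, -3, -3, 0]),
  (!![6, 0, 0, -12; 1, 3, -1, 0; -1, -3, 9, 0; 0, 3, 3, 6],
    !![0, -18, 6, -12; 1, 0, 0, -2; -1, 0, 0, -6; 1, 3, 3, 0]),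
  (!![0, 0, 0, 0; 0, 9, 3, 0; 0, 9, 3, 0; 0, 0, 0, 12],
    !![0, 0, 0, 0; 0, 0, 0, 0; 0, 0, 0, 0; 0, 0, 0, 0]),
  (!![12, 0, 0, 0; 0, 12, 0, 0; 0, 0, 0, 0; 0, 0, 0, 0],
    !![0, 0, 0, 0; 0, 0, 0, 0; 0, 0, 0, 0; 0, 0, 0, 0])
  ]

/-- Eighteen times the lift of `ga`. -/
def nZ : ZPair :=
  (!![-6, 18, 18, 36; -2, -3, -3, -6; 0, 27, 3, 6; 0, 0, -6, 6],
    !![-12, -18, 18, 36; -1, -6, 6, -6; 3, 18, 6, -6; 3, -9, -3, 12])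

/-- The lift of `gb`. -/
def bZ : ZPair :=
  (!![-1, 0, 0, 0; 0, 1, 0, 0; 0, 0, 1, 0; 0, 0, 0, 0],
    !![-1, 0, 0, 0; 0, 0, 0, 0; 0, 0, 0, 0; 0, 0, 0, 1])

/-- The scalar matrix `c`. -/
def cZ (c : ℤ) : ZPair := (Matrix.diagonal fun _ => c, 0)

theorem ev_cZ {k : Type} [Field k] (w : k) (c : ℤ) : ev w (cZ c) = (c : k) • 1 := by
  ext i j
  simp [ev, cZ, Matrix.one_apply, Matrix.diagonal_apply]

theorem nZ_sq : zmul nZ nZ = cZ (-324) := by decide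
theorem bZ_cube : zmul (zmul bZ bZ) bZ = cZ 1 := by decide
theorem nbZ_pow : zmul (zmul (zmul (zmul nZ bZ) (zmul nZ bZ)) (zmul (zmul nZ bZ) (zmul nZ bZ)))
    (zmul nZ bZ) = cZ (18 ^ 5) := by decide
theorem nZ_q : ∀ i, zmul nZ (qZ i) = zmul (qZ (ga.val i)) nZ := by decide
theorem bZ_q : ∀ i, zmul bZ (qZ i) = zmul (qZ (gb.val i)) bZ := by decide

theorem h18 {k : Type} [Field k] (h2 : (2 : k) ≠ 0) (h3 : (3 : k) ≠ 0) : (18 : k) ≠ 0 := by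
  have : (18 : k) = 2 * 3 * 3 := by norm_num
  rw [this]; exact mul_ne_zero (mul_ne_zero h2 h3) h3

/-- The data of the lifts of the generators. -/
theorem exists_gens {k : Type} [Field k] (h2 : (2 : k) ≠ 0) (h3 : (3 : k) ≠ 0) {w : k}
    (hw : 1 + w + w ^ 2 = 0) : ∃ A B : GLmk 4 k, A.val = (18 : k)⁻¹ • ev w nZ ∧ B.val = ev w bZ ∧
      A.val ^ 2 = (-1 : k) • 1 ∧ B ^ 3 = 1 ∧ (A * B) ^ 5 = 1 := by
  have h := h18 h2 h3
  have eA : ((18 : k)⁻¹ • ev w nZ) * ((18 : k)⁻¹ • ev w nZ) = (-1 : k) • 1 := by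
    rw [smul_mul_smul_comm, ev_mul hw, nZ_sq, ev_cZ, smul_smul]
    congr 1
    push_cast
    field_simp
    norm_num
  have eB : ev w bZ * ev w bZ * ev w bZ = 1 := by
    rw [ev_mul hw, ev_mul hw, bZ_cube, ev_cZ]; simp
  let A : GLmk 4 k := ⟨(18 : k)⁻¹ • ev w nZ, -((18 : k)⁻¹ • ev w nZ), by
    rw [mul_neg, eA]; simp, by rw [neg_mul, eA]; simp⟩
  let B : GLmk 4 k := ⟨ev w bZ, ev w bZ * ev w bZ, by rw [← mul_assoc, eB], eB⟩
  refine ⟨A, B, rfl, rfl, ?_, ?_, ?_⟩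
  · rw [sq]; exact eA
  · apply Units.ext
    rw [pow_succ, sq, Units.val_mul, Units.val_mul]; exact eB
  · apply Units.ext
    have e1 : (A * B).val = (18 : k)⁻¹ • ev w (zmul nZ bZ) := by
      rw [Units.val_mul, ← ev_mul hw, ← smul_mul_assoc]
    rw [Units.val_pow_eq_pow_val, e1, smul_pow, Units.val_one]
    have e2 : ev w (zmul nZ bZ) ^ 5 = ev w (cZ (18 ^ 5)) := by
      rw [← nbZ_pow, ← ev_mul hw _ (zmul nZ bZ), ← ev_mul hw (zmul (zmul nZ bZ) (zmul nZ bZ)),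
        ← ev_mul hw (zmul nZ bZ) (zmul nZ bZ)]
      simp only [pow_succ, pow_zero, one_mul, mul_assoc]
    rw [e2, ev_cZ, smul_smul]
    have : ((18 : k)⁻¹ ^ 5 * ((18 ^ 5 : ℤ) : k)) = 1 := by
      rw [inv_pow, Int.cast_pow, Int.cast_ofNat]
      exact inv_mul_cancel₀ (pow_ne_zero _ h)
    rw [this, one_smul]

theorem centralizer_q {k : Type} [Field k] (h2 : (2 : k) ≠ 0) (h3 : (3 : k) ≠ 0) {w : k}
    (M : Matrix (Fin 4) (Fin 4) k) (hM : ∀ i, M * ev w (qZ i) = ev w (qZ i) * M) :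
    ∃ s : k, M = s • 1 := by
  have h := h18 h2 h3
  have h9 : (9 : k) ≠ 0 := by
    have : (9 : k) = 3 * 3 := by norm_num
    rw [this]; exact mul_ne_zero h3 h3
  have h12 : (12 : k) ≠ 0 := by
    have : (12 : k) = 2 * 2 * 3 := by norm_num
    rw [this]; exact mul_ne_zero (mul_ne_zero h2 h2) h3
  have e4 : ∀ i j, (M * ev w (qZ 4)) i j = (ev w (qZ 4) * M) i j := fun i j => by rw [hM]
  have e3 : ∀ i j, (M * ev w (qZ 3)) i j = (ev w (qZ 3) * M) i j := fun i j => by rw [hM]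
  have e0 : ∀ i j, (M * ev w (qZ 0)) i j = (ev w (qZ 0) * M) i j := fun i j => by rw [hM]
  have f02 := e4 0 2
  have f03 := e4 0 3
  have f12 := e4 1 2
  have f13 := e4 1 3
  have f20 := e4 2 0
  have f21 := e4 2 1
  have f30 := e4 3 0
  have f31 := e4 3 1
  have g01 := e3 0 1
  have g10 := e3 1 0
  have g12 := e3 1 2
  have g13 := e3 1 3
  have g31 := e3 3 1
  have k01 := e0 0 1
  have k03 := e0 0 3
  simp [Matrix.mul_apply, Fin.sum_univ_four, ev, qZ, h12] at f02 f03 f12 f13 f20 f21 f30 f31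
  simp [Matrix.mul_apply, Fin.sum_univ_four, ev, qZ, h12, h9, h3, f02, f03, f12, f13, f20, f21,
    f30, f31] at g01 g10 g12 g13 g31
  simp [Matrix.mul_apply, Fin.sum_univ_four, ev, qZ, h12, h9, h3, f02, f03, f12, f13, f20, f21,
    f30, f31, g01, g10, g13, g31] at k01 k03
  have d1 : M 1 1 = M 0 0 := mul_left_cancel₀ h (by linear_combination -k01)
  have d3 : M 3 3 = M 0 0 := mul_left_cancel₀ h12 (by linear_combination -k03)
  have d2 : M 2 2 = M 0 0 := mul_left_cancel₀ h3 (by linear_combination -g12 + 3 * d1)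
  refine ⟨M 0 0, ?_⟩
  ext i j
  fin_cases i <;> fin_cases j <;> simp [f02, f03, f12, f13, f20, f21, f30, f31, g01, g10, g13, g31,
    d1, d2, d3]

theorem exists_P {k : Type} [Field k] (h2 : (2 : k) ≠ 0) (h3 : (3 : k) ≠ 0) {w : k}
    (hw : 1 + w + w ^ 2 = 0) (x : A5) :
    ∃ P : GLmk 4 k, ∀ i, P.val * ev w (qZ i) = ev w (qZ (x.val i)) * P.val := by
  have hx : x ∈ Submonoid.closure ({ga, gb} : Set A5) := by
    rw [← Subgroup.closure_toSubmonoid_of_finite, closure_gen]; trivial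
  obtain ⟨A, B, hA, hB, -⟩ := exists_gens h2 h3 hw
  induction hx using Submonoid.closure_induction with
  | mem x hx =>
    rcases hx with rfl | rfl
    · refine ⟨A, fun i => ?_⟩
      rw [hA, smul_mul_assoc, mul_smul_comm, ev_mul hw, ev_mul hw, nZ_q]
    · refine ⟨B, fun i => ?_⟩
      rw [hB, ev_mul hw, ev_mul hw, bZ_q]
  | one => exact ⟨1, fun i => by simp⟩
  | mul x y _ _ hx hy =>
    obtain ⟨P, hP⟩ := hx
    obtain ⟨Q, hQ⟩ := hy
    refine ⟨P * Q, fun i => ?_⟩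
    rw [Units.val_mul, mul_assoc, hQ, ← mul_assoc, hP, mul_assoc]
    rfl

theorem unique_P {k : Type} [Field k] (h2 : (2 : k) ≠ 0) (h3 : (3 : k) ≠ 0) {w : k}
    (x : A5) (P Q : GLmk 4 k)
    (hP : ∀ i, P.val * ev w (qZ i) = ev w (qZ (x.val i)) * P.val)
    (hQ : ∀ i, Q.val * ev w (qZ i) = ev w (qZ (x.val i)) * Q.val) :
    pglQuot 4 k P = pglQuot 4 k Q := by
  have u : Q⁻¹.val * Q.val = 1 := by rw [← Units.val_mul, inv_mul_cancel, Units.val_one]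
  have v : Q.val * Q⁻¹.val = 1 := by rw [← Units.val_mul, mul_inv_cancel, Units.val_one]
  obtain ⟨s, hs⟩ := centralizer_q h2 h3 (w := w) (Q⁻¹.val * P.val) (fun i => by
    have e : Q⁻¹.val * ev w (qZ (x.val i)) = ev w (qZ i) * Q⁻¹.val := by
      calc Q⁻¹.val * ev w (qZ (x.val i)) =
          Q⁻¹.val * (ev w (qZ (x.val i)) * Q.val) * Q⁻¹.val := by
            rw [mul_assoc, mul_assoc, v, mul_one]
        _ = _ := by rw [← hQ, ← mul_assoc, u, one_mul]
    rw [mul_assoc, hP, ← mul_assoc, e, mul_assoc])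
  have h1 : P.val = s • Q.val := by
    calc P.val = Q.val * (Q⁻¹.val * P.val) := by rw [← mul_assoc, v, one_mul]
      _ = _ := by rw [hs, mul_smul_comm, mul_one]
  rw [pgl_eq_iff]
  refine ⟨s, ?_, h1⟩
  rintro rfl
  rw [zero_smul] at h1
  exact P.ne_zero h1

theorem exists_spin {k : Type} [Field k] (h2 : (2 : k) ≠ 0) (h3 : (3 : k) ≠ 0) {w : k}
    (hw : 1 + w + w ^ 2 = 0) : ∃ ψ : A5 →* PGLmk 4 k, ∃ A B : GLmk 4 k,
      pglQuot 4 k A = ψ ga ∧ pglQuot 4 k B = ψ gb ∧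
      A.val = (18 : k)⁻¹ • ev w nZ ∧ B.val = ev w bZ ∧
      A.val ^ 2 = (-1 : k) • 1 ∧ B ^ 3 = 1 ∧ (A * B) ^ 5 = 1 := by
  obtain ⟨A, B, hA, hB, r1, r2, r3⟩ := exists_gens h2 h3 hw
  choose P hP using exists_P h2 h3 hw
  let ψ : A5 →* PGLmk 4 k := MonoidHom.mk' (fun x => pglQuot 4 k (P x)) (fun x y => by
    rw [← map_mul]
    refine unique_P h2 h3 (x * y) _ _ (hP _) (fun i => ?_)
    rw [Units.val_mul, mul_assoc, hP, ← mul_assoc, hP, mul_assoc]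
    rfl)
  refine ⟨ψ, A, B, unique_P h2 h3 ga _ _ (fun i => ?_) (hP _),
    unique_P h2 h3 gb _ _ (fun i => ?_) (hP _), hA, hB, r1, r2, r3⟩
  · rw [hA, smul_mul_assoc, mul_smul_comm, ev_mul hw, ev_mul hw, nZ_q]
  · rw [hB, ev_mul hw, ev_mul hw, bZ_q]

theorem spin_regular {k : Type} [Field k] (h2 : (2 : k) ≠ 0) (h3 : (3 : k) ≠ 0) {w : k}
    (hw : 1 + w + w ^ 2 = 0) {ψ : A5 →* PGLmk 4 k} {A B : GLmk 4 k}
    (ha : pglQuot 4 k A = ψ ga) (hb : pglQuot 4 k B = ψ gb)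
    (hA : A.val = (18 : k)⁻¹ • ev w nZ) (hB : B.val = ev w bZ) : IsRegularHom ψ := by
  intro W hW
  have h := h18 h2 h3
  have h36 : (36 : k) ≠ 0 := by
    have : (36 : k) = 18 * 2 := by norm_num
    rw [this]; exact mul_ne_zero h h2
  have h324 : (324 : k) ≠ 0 := by
    have : (324 : k) = 18 * 18 := by norm_num
    rw [this]; exact mul_ne_zero h h
  have hw0 : w ≠ 0 := by rintro rfl; simp at hw
  have hw1 : 1 + w ≠ 0 := by
    intro h0
    apply hw0
    have : w * w = 0 := by linear_combination hw - h0
    exact mul_self_eq_zero.mp this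
  have iA : ∀ v ∈ W, (ev w nZ).mulVec v ∈ W := by
    intro v hv
    have := hW A (ha ▸ ⟨ga, rfl⟩) v hv
    rw [hA, Matrix.smul_mulVec] at this
    exact (W.smul_mem_iff (inv_ne_zero h)).mp this
  have iB : ∀ v ∈ W, (ev w bZ).mulVec v ∈ W := by
    intro v hv
    have := hW B (hb ▸ ⟨gb, rfl⟩) v hv
    rwa [hB] at this
  have fA : ∀ a b c d : k, ![a, b, c, d] ∈ W → ![(-6 - 12 * w) * a + (18 - 18 * w) * b +
      (18 + 18 * w) * c + (36 + 36 * w) * d, (-2 - w) * a + (-3 - 6 * w) * b + (-3 + 6 * w) * c +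
      (-6 - 6 * w) * d, 3 * w * a + (27 + 18 * w) * b + (3 + 6 * w) * c + (6 - 6 * w) * d,
      3 * w * a - 9 * w * b + (-6 - 3 * w) * c + (6 + 12 * w) * d] ∈ W := by
    intro a b c d hv
    convert iA _ hv using 1
    funext i
    fin_cases i <;> simp [ev, nZ, Matrix.mulVec, dotProduct, Fin.sum_univ_four] <;> ring
  have fB : ∀ a b c d : k, ![a, b, c, d] ∈ W → ![(-1 - w) * a, b, c, w * d] ∈ W := by
    intro a b c d hv
    convert iB _ hv using 1
    funext i
    fin_cases i <;> simp [ev, bZ, Matrix.mulVec, dotProduct, Fin.sum_univ_four] <;>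
      (try left) <;> ring
  have comb : ∀ (r s t a b c d a' b' c' d' a'' b'' c'' d'' : k), ![a, b, c, d] ∈ W →
      ![a', b', c', d'] ∈ W → ![a'', b'', c'', d''] ∈ W →
      ![r * a + s * a' + t * a'', r * b + s * b' + t * b'', r * c + s * c' + t * c'',
        r * d + s * d' + t * d''] ∈ W := by
    intro r s t a b c d a' b' c' d' a'' b'' c'' d'' x y z
    convert W.add_mem (W.add_mem (W.smul_mem r x) (W.smul_mem s y)) (W.smul_mem t z) using 1
    funext i
    fin_cases i <;> simp
  have tr : ∀ {a b c d a' b' c' d' : k}, ![a, b, c, d] ∈ W → a = a' → b = b' → c = c' → d = d' →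
      ![a', b', c', d'] ∈ W := by
    rintro a b c d _ _ _ _ hv rfl rfl rfl rfl
    exact hv
  have sc : ∀ {r a b c d : k}, r ≠ 0 → ![r * a, r * b, r * c, r * d] ∈ W → ![a, b, c, d] ∈ W := by
    intro r a b c d hr hv
    rw [← W.smul_mem_iff hr]
    convert hv using 1
    funext i
    fin_cases i <;> simp
  have p0 : ∀ a b c d : k, ![a, b, c, d] ∈ W → ![3 * a, 0, 0, 0] ∈ W := by
    intro a b c d hv
    have v1 := fB _ _ _ _ hv
    have v2 := fB _ _ _ _ v1
    exact tr (comb 1 w (-1 - w) _ _ _ _ _ _ _ _ _ _ _ _ hv v1 v2)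
      (by linear_combination -(w + 3) * a * hw) (by ring) (by ring)
      (by linear_combination (1 - w) * d * hw)
  have p3 : ∀ a b c d : k, ![a, b, c, d] ∈ W → ![0, 0, 0, 3 * d] ∈ W := by
    intro a b c d hv
    have v1 := fB _ _ _ _ hv
    have v2 := fB _ _ _ _ v1
    exact tr (comb 1 (-1 - w) w _ _ _ _ _ _ _ _ _ _ _ _ hv v1 v2)
      (by linear_combination (w + 2) * a * hw) (by ring) (by ring)
      (by linear_combination (w - 2) * d * hw)
  have q0 : ∀ a b c d : k, ![a, b, c, d] ∈ W → a ≠ 0 → ![1, 0, 0, 0] ∈ W := by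
    intro a b c d hv h0
    exact sc (mul_ne_zero h3 h0) (tr (p0 _ _ _ _ hv) (by ring) (by ring) (by ring) (by ring))
  have q3 : ∀ a b c d : k, ![a, b, c, d] ∈ W → d ≠ 0 → ![0, 0, 0, 1] ∈ W := by
    intro a b c d hv h0
    exact sc (mul_ne_zero h3 h0) (tr (p3 _ _ _ _ hv) (by ring) (by ring) (by ring) (by ring))
  have big : ![1, 0, 0, 0] ∈ W → ![0, 0, 0, 1] ∈ W → W = ⊤ := by
    intro m0 m3
    have x1 := fA _ _ _ _ m0
    have x3 := fA _ _ _ _ m3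
    have y1 := comb 1 (-(-6 - 12 * w)) (-(3 * w)) _ _ _ _ _ _ _ _ _ _ _ _ x1 m0 m3
    have y3 := comb 1 (-(36 + 36 * w)) (-(6 + 12 * w)) _ _ _ _ _ _ _ _ _ _ _ _ x3 m0 m3
    have z1 : ![0, 1, 0, 0] ∈ W := by
      exact sc h36 (tr (comb (-(6 - 6 * w)) (3 * w) 0 _ _ _ _ _ _ _ _ _ _ _ _ y1 y3 m0)
        (by ring) (by linear_combination -24 * hw) (by ring) (by ring))
    have z2 : ![0, 0, 1, 0] ∈ W := by
      exact sc h36 (tr (comb (-6 - 6 * w) (2 + w) 0 _ _ _ _ _ _ _ _ _ _ _ _ y1 y3 m0)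
        (by ring) (by ring) (by linear_combination -24 * hw) (by ring))
    rw [eq_top_iff]
    intro u _
    convert W.add_mem (comb (u 0) (u 1) (u 2) _ _ _ _ _ _ _ _ _ _ _ _ m0 z1 z2)
      (W.smul_mem (u 3) m3) using 1
    funext i
    fin_cases i <;> simp
  by_cases m0 : ![1, 0, 0, 0] ∈ W
  · right
    refine big m0 ?_
    exact q3 _ _ _ _ (fA _ _ _ _ m0) (by simpa using ⟨h3, hw0⟩)
  by_cases m3 : ![0, 0, 0, 1] ∈ W
  · right
    refine big ?_ m3
    refine q0 _ _ _ _ (fA _ _ _ _ m3) ?_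
    have : (-6 - 12 * w) * 0 + (18 - 18 * w) * 0 + (18 + 18 * w) * 0 + (36 + 36 * w) * 1 =
      36 * (1 + w) := by ring
    rw [this]
    exact mul_ne_zero h36 hw1
  left
  have z0 : ∀ a b c d : k, ![a, b, c, d] ∈ W → a = 0 := by
    intro a b c d hv
    by_contra h0
    exact m0 (q0 _ _ _ _ hv h0)
  have z3 : ∀ a b c d : k, ![a, b, c, d] ∈ W → d = 0 := by
    intro a b c d hv
    by_contra h0
    exact m3 (q3 _ _ _ _ hv h0)
  rw [eq_bot_iff]
  intro u hu
  have hu' : ![u 0, u 1, u 2, u 3] ∈ W := by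
    convert hu using 1
    funext i
    fin_cases i <;> rfl
  have a0 := z0 _ _ _ _ hu'
  have a3 := z3 _ _ _ _ hu'
  have b0 := z0 _ _ _ _ (fA _ _ _ _ hu')
  have b3 := z3 _ _ _ _ (fA _ _ _ _ hu')
  rw [a0, a3] at b0 b3
  have c1 : u 1 = 0 := by
    have : 324 * u 1 = 0 := by
      linear_combination -(-6 - 3 * w) * b0 + (18 + 18 * w) * b3 + 216 * u 1 * hw
    exact (mul_eq_zero.mp this).resolve_left h324
  have c2 : u 2 = 0 := by
    have : 324 * u 2 = 0 := by
      linear_combination (-9 * w) * b0 - (18 - 18 * w) * b3 + 216 * u 2 * hw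
    exact (mul_eq_zero.mp this).resolve_left h324
  rw [Submodule.mem_bot]
  funext i
  fin_cases i
  · exact a0
  · exact c1
  · exact c2
  · exact a3

theorem exists_prim {k : Type} [Field k] [IsAlgClosed k] (n : ℕ) [NeZero n] (hn : (n : k) ≠ 0) :
    ∃ z : k, IsPrimitiveRoot z n := by
  haveI : NeZero (n : k) := ⟨hn⟩
  obtain ⟨z, hz⟩ := IsAlgClosed.exists_root (Polynomial.cyclotomic n k)
    (by rw [Polynomial.degree_cyclotomic]; exact_mod_cast (Nat.totient_pos.mpr (NeZero.pos n)).ne')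
  exact ⟨z, Polynomial.isRoot_cyclotomic_iff.mp hz⟩

theorem small_ne_zero {k : Type} [Field k]
    (hchar : CharZero k ∨ ∃ p : ℕ, p.Prime ∧ 7 ≤ p ∧ CharP k p) (n : ℕ) (h0 : 0 < n) (h7 : n < 7) :
    (n : k) ≠ 0 := by
  rcases hchar with h | ⟨p, -, hp, h⟩
  · exact Nat.cast_ne_zero.mpr h0.ne'
  · rw [Ne, CharP.cast_eq_zero_iff k p]
    intro hd
    have := Nat.le_of_dvd h0 hd
    omega


/-- Section 1.8, case `m = 4`: there are exactly two conjugacy classes of regular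
homomorphisms `A₅ → PGL₄(k)`, and exactly one of the two classes lifts to `GL₄(k)`. -/
theorem regular_homs_PGL_four
    (k : Type) [Field k] [IsAlgClosed k]
    (hchar : CharZero k ∨ ∃ p : ℕ, p.Prime ∧ 7 ≤ p ∧ CharP k p) :
    ∃ ψ ψ' : A5 →* PGLmk 4 k,
      IsRegularHom ψ ∧ IsRegularHom ψ' ∧ ¬ PGLConj ψ ψ' ∧
      (∀ ψ'' : A5 →* PGLmk 4 k, IsRegularHom ψ'' → PGLConj ψ'' ψ ∨ PGLConj ψ'' ψ') ∧
      (∃ ψ₀, PGLConj ψ ψ₀ ∧ LiftsToGL ψ₀) ∧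
      ¬ (∃ ψ₀, PGLConj ψ' ψ₀ ∧ LiftsToGL ψ₀) := by
  have h2 : (2 : k) ≠ 0 := by exact_mod_cast small_ne_zero hchar 2 (by norm_num) (by norm_num)
  have h3 : (3 : k) ≠ 0 := by exact_mod_cast small_ne_zero hchar 3 (by norm_num) (by norm_num)
  have h5 : (5 : k) ≠ 0 := by exact_mod_cast small_ne_zero hchar 5 (by norm_num) (by norm_num)
  obtain ⟨ω, hω⟩ := exists_prim (k := k) 3 (by exact_mod_cast h3)
  obtain ⟨ζ, hζ⟩ := exists_prim (k := k) 5 (by exact_mod_cast h5)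
  obtain ⟨ψ', A', B', ha', hb', hA', hB', rA, rB, rC⟩ := exists_spin h2 h3 (prim3 hω)
  have reg' := spin_regular h2 h3 (prim3 hω) ha' hb' hA' hB'
  have reg := std_regular k h3 h5
  have hsq : ∀ {φ : A5 →* PGLmk 4 k}, IsRegularHom φ → ∀ {A B : GLmk 4 k} {l : k},
      NormLift φ A B l → l = 1 ∨ l = -1 := by
    intro φ hφ A B l N
    obtain ⟨μ, hμ⟩ := IsAlgClosed.exists_pow_nat_eq l (n := 2) (by norm_num)
    exact normLift_sq h2 h3 h5 hφ N hμ hω hζ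
  have hsq2 : ∀ {φ : A5 →* PGLmk 4 k}, IsRegularHom φ → ∀ {A B : GLmk 4 k} {l : k},
      NormLift φ A B l → l ^ 2 = 1 := by
    intro φ hφ A B l N
    rcases hsq hφ N with rfl | rfl <;> norm_num
  have hrig : ∀ {φ χ : A5 →* PGLmk 4 k}, IsRegularHom φ → IsRegularHom χ →
      ∀ {A B C D : GLmk 4 k} {l : k}, NormLift φ A B l → NormLift χ C D l → PGLConj χ φ := by
    intro φ χ hφ hχ A B C D l N N'
    obtain ⟨μ, hμ⟩ := IsAlgClosed.exists_pow_nat_eq l (n := 2) (by norm_num)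
    exact rigidity h2 h3 h5 hφ hχ N N' hμ hω hζ
  -- a lifting homomorphism has invariant one
  have hlift : ∀ {φ : A5 →* PGLmk 4 k}, IsRegularHom φ → LiftsToGL φ →
      ∀ {A B : GLmk 4 k} {l : k}, NormLift φ A B l → l = 1 := by
    rintro φ hφ ⟨ρ, hρ⟩ A B l N
    refine sign_eq N (hsq2 hφ N) (hρ ga).symm (hρ gb).symm (one_pow 2) ?_ ?_ ?_
    · rw [← Units.val_pow_eq_pow_val, ← map_pow, ga_sq, map_one, Units.val_one, one_smul]
    · rw [← map_pow, gb_cube, map_one]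
    · rw [← map_mul, ← map_pow, gab_pow, map_one]
  have hstd : LiftsToGL ((pglQuot 4 k).comp (stdRep k)) := ⟨stdRep k, fun x => rfl⟩
  obtain ⟨S, T, l, N⟩ := exists_normLift ((pglQuot 4 k).comp (stdRep k))
  obtain ⟨S', T', l', N'⟩ := exists_normLift ψ'
  obtain rfl : l = 1 := hlift reg hstd N
  obtain rfl : l' = -1 := sign_eq N' (hsq2 reg' N') ha' hb' (by norm_num) rA rB rC
  have hnl : ¬ LiftsToGL ψ' := by
    intro h
    have h1 := hlift reg' h N'
    apply h2
    linear_combination -h1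
  -- the lifting property is invariant under conjugation
  have hconj : ∀ {φ χ : A5 →* PGLmk 4 k}, PGLConj φ χ → LiftsToGL χ → LiftsToGL φ := by
    rintro φ χ ⟨y, hy⟩ ⟨ρ, hρ⟩
    obtain ⟨g, rfl⟩ := pglQuot_surj y
    refine ⟨(MulAut.conj g⁻¹).toMonoidHom.comp ρ, fun x => ?_⟩
    have e : pglQuot 4 k ((MulAut.conj g⁻¹).toMonoidHom.comp ρ x) =
        (pglQuot 4 k g)⁻¹ * χ x * pglQuot 4 k g := by
      simp [hρ]
    rw [e, hy]
    group
  refine ⟨(pglQuot 4 k).comp (stdRep k), ψ', reg, reg', ?_, ?_, ?_, ?_⟩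
  · intro h
    exact hnl (hconj h.symm hstd)
  · intro φ hφ
    obtain ⟨A, B, l, M⟩ := exists_normLift φ
    rcases hsq hφ M with rfl | rfl
    · exact Or.inl (hrig reg hφ N M)
    · exact Or.inr (hrig reg' hφ N' M)
  · exact ⟨_, ⟨1, fun x => by simp⟩, hstd⟩
  · rintro ⟨φ, h, hφ⟩
    exact hnl (hconj h hφ)
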